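/- Let p be an odd prime, n ≥ 2 an integer, and A an integer with 0 < |A| < p/2. Let k be an integer (positive or negative) with k ≠ 1, |k| < (p−1)/2, and gcd(k, p−1) = 1, and let f(x) = (A x^k mod p) on I, where for negative k, x^k means (x^{-1})^{|k|} with x^{-1} the inverse of x mod p. If p > 37·|k−1|²·n², then f is not of Type (iii): there are no indices i, j with 0 ≤ i, j ≤ n−1 and f(I_i) ⊆ I_j. -/

import Mathlib

/-- `Iclass p n j` is the residue class `I_j = {x : 1 ≤ x ≤ p-1, x ≡ j (mod n)}`. -/
def Iclass (p n j : ℕ) : Finset ℕ :=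
  (Finset.Icc 1 (p - 1)).filter fun x => x % n = j

/-- `fmapz p A k x` is `A x^k mod p` for an integer exponent `k`, the least residue in
`{0, …, p-1}`, where for negative `k`, `x^k` means `(x⁻¹)^|k|` with `x⁻¹` the inverse
of `x` mod `p`. -/
def fmapz (p : ℕ) (A : ℤ) (k : ℤ) (x : ℕ) : ℕ :=
  ((A : ZMod p) *
    (if 0 ≤ k then (x : ZMod p) ^ k.toNat else ((x : ZMod p)⁻¹) ^ (-k).toNat)).val

open Polynomial in
theorem natDegree_twistedTrace {E : Type*} [Field E] {p s m e : ℕ} (hp : 1 < p) (he : 0 < e)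
    {P : E[X]} (hP : P.natDegree = m + e) :
    (∑ i ∈ Finset.range (s + 1), P ^ p ^ i * X ^ (m * (p ^ s - p ^ i))).natDegree
      = (m + e) * p ^ s := by
  have hP0 : P ≠ 0 := by
    rintro rfl
    simp at hP
    omega
  have hR : 0 < p ^ s := by positivity
  have htop : (P ^ p ^ s * X ^ (m * (p ^ s - p ^ s)) : E[X]).natDegree = (m + e) * p ^ s := by
    simp [natDegree_pow, hP, mul_comm]
  rw [Finset.sum_range_succ, natDegree_add_eq_right_of_natDegree_lt, htop]
  rw [htop]
  refine lt_of_le_of_lt (b := (m + e) * p ^ s - 1) ?_ (Nat.sub_lt (by positivity) one_pos)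
  refine natDegree_sum_le_of_forall_le _ _ fun i hi => ?_
  have hi' : p ^ i < p ^ s := Nat.pow_lt_pow_right hp (Finset.mem_range.mp hi)
  rw [natDegree_mul_X_pow _ (pow_ne_zero _ hP0), natDegree_pow, hP]
  obtain ⟨d, hd⟩ := Nat.exists_eq_add_of_lt hi'
  rw [hd, show p ^ i + d + 1 - p ^ i = d + 1 by omega]
  apply Nat.le_sub_one_of_lt
  nlinarith

/-- Stepanov's method for the fibres of the trace: the number of nonzero `x` in the field with
`p ^ (2 * (s + 1))` elements at which the trace of `P(x) / x ^ m` equals `c`. -/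
theorem card_trace_fiber_le {E : Type*} [Field E] [Fintype E] {p s m e : ℕ} [Fact p.Prime]
    [CharP E p] (hE : Fintype.card E = p ^ (2 * (s + 1))) (he : 0 < e) (hpe : ¬ p ∣ e)
    {P : Polynomial E} (hP : P.natDegree = m + e)
    {c : E} (Z : Finset E)
    (hZ : ∀ x ∈ Z, x ≠ 0 ∧
      ∑ i ∈ Finset.range (2 * (s + 1)), (P.eval x / x ^ m) ^ p ^ i = c) :
    Z.card ≤ p ^ (s + 1) * p ^ s + (2 * (m + e) + 1) * p ^ (s + 1) := by
  classical
  open Polynomial in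
  have hp : p.Prime := Fact.out
  set R := p ^ s with hRdef
  set Q := p ^ (s + 1) with hQdef
  have hR : 0 < R := pow_pos hp.pos _
  have hQ0 : 0 < Q := pow_pos hp.pos _
  have hQR : Q = p * R := by rw [hQdef, pow_succ, mul_comm]
  set T : E[X] := ∑ i ∈ Finset.range (s + 1), P ^ p ^ i * X ^ (m * (R - p ^ i)) with hT
  have hTdeg : T.natDegree = (m + e) * R := natDegree_twistedTrace hp.one_lt he hP
  have hT0 : T ≠ 0 := by
    intro h
    rw [h, natDegree_zero] at hTdeg
    have : 0 < (m + e) * R := by positivity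
    omega
  let t : E → E := fun x => ∑ i ∈ Finset.range (s + 1), (P.eval x / x ^ m) ^ p ^ i
  have hTt : ∀ x : E, x ≠ 0 → T.eval x = x ^ (m * R) * t x := by
    intro x hx
    simp only [hT, t, eval_finsetSum, Finset.mul_sum, eval_mul, eval_pow, eval_X]
    refine Finset.sum_congr rfl fun i hi => ?_
    have hle : p ^ i ≤ R := Nat.pow_le_pow_right hp.pos (Nat.lt_succ_iff.mp (Finset.mem_range.mp hi))
    obtain ⟨d, hd⟩ := Nat.exists_eq_add_of_le hle
    rw [hd, Nat.add_sub_cancel_left, div_pow, mul_add, pow_add, ← pow_mul]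
    field_simp
  have htt : ∀ x ∈ Z, t x ^ Q = c - t x := by
    intro x hx
    have h := (hZ x hx).2
    rw [two_mul, Finset.sum_range_add] at h
    rw [← h]
    simp only [t, hQdef]
    rw [add_sub_cancel_left, sum_pow_char_pow]
    refine Finset.sum_congr rfl fun i _ => ?_
    rw [← pow_mul, ← pow_add, add_comm]
  have hxQ : ∀ x : E, (x ^ Q) ^ Q = x := by
    intro x
    rw [← pow_mul, hQdef, ← pow_add, ← two_mul, ← hE]
    exact FiniteField.pow_card x
  let ι := Fin R × Fin (R + (m + e) + 1) × Fin p
  let H : ι → E[X] := fun v =>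
    X ^ (v.1.1 * Q + v.2.1.1) * ((C c * X ^ (m * R) - T) ^ v.2.2.1 * X ^ (m * R * (p - 1 - v.2.2.1)))
  let G : ι → E[X] := fun v =>
    X ^ (v.1.1 + v.2.1.1 * Q) * (T ^ v.2.2.1 * X ^ (m * R * (p - 1 - v.2.2.1)))
  have hHdeg : ∀ v, (H v).natDegree < Q * (R + (m + e)) + 1 := by
    rintro ⟨i, i', j⟩
    have h1 : (C c * X ^ (m * R) - T).natDegree ≤ (m + e) * R := by
      refine (natDegree_sub_le _ _).trans (max_le ((natDegree_C_mul_X_pow_le _ _).trans ?_) hTdeg.le)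
      gcongr
      omega
    have h2 : (H ⟨i, i', j⟩).natDegree
        ≤ (i.1 * Q + i'.1) + ((m + e) * R * j.1 + m * R * (p - 1 - j.1)) := by
      refine natDegree_mul_le_of_le (natDegree_X_pow_le _) (natDegree_mul_le_of_le ?_ (natDegree_X_pow_le _))
      rw [mul_comm ((m + e) * R)]
      exact natDegree_pow_le_of_le _ h1
    have hi : i.1 + 1 ≤ R := i.2
    have hi' : i'.1 ≤ R + (m + e) := Nat.lt_succ_iff.mp i'.2
    have hj : j.1 + (p - 1 - j.1) = p - 1 := by have := j.2; omega
    have h3 : (m + e) * R * j.1 + m * R * (p - 1 - j.1) ≤ (m + e) * R * (p - 1) := by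
      conv_rhs => rw [← hj]
      rw [mul_add]
      gcongr
      omega
    have h4 : (m + e) * R * (p - 1) + (m + e) * R = (m + e) * Q := by
      obtain ⟨r, hr⟩ := Nat.exists_eq_add_of_le hp.one_le
      rw [hQR, hr, Nat.add_sub_cancel_left]
      ring
    have h5 : (i.1 + 1) * Q ≤ R * Q := Nat.mul_le_mul_right _ hi
    have h6 : (m + e) ≤ (m + e) * R := Nat.le_mul_of_pos_right _ hR
    have h7 : R ≤ Q := by rw [hQR]; exact Nat.le_mul_of_pos_left _ hp.pos
    nlinarith
  obtain ⟨a, ha0, haH⟩ : ∃ a : ι → E, a ≠ 0 ∧ ∑ v, C (a v) * H v = 0 := by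
    let N := Q * (R + (m + e)) + 1
    let L : (ι → E) →ₗ[E] degreeLT E N :=
      { toFun := fun a => ⟨∑ v, C (a v) * H v, by
          refine Submodule.sum_mem _ fun v _ => ?_
          rw [mem_degreeLT]
          refine (degree_le_natDegree).trans_lt ?_
          exact_mod_cast (natDegree_C_mul_le _ _).trans_lt (hHdeg v)⟩
        map_add' := fun x y => by
          ext1
          simp [add_mul, Finset.sum_add_distrib]
        map_smul' := fun r x => by
          ext1
          simp [Finset.smul_sum, smul_eq_C_mul, mul_assoc] }
    have hdim : Module.finrank E (degreeLT E N) < Module.finrank E (ι → E) := by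
      rw [(degreeLTEquiv E N).finrank_eq, Module.finrank_fin_fun, Module.finrank_fintype_fun_eq_card]
      simp only [ι, Fintype.card_prod, Fintype.card_fin]
      have : 2 ≤ Q := by
        rw [hQR]
        nlinarith [hp.two_le]
      have h8 : R * ((R + (m + e) + 1) * p) = Q * (R + (m + e)) + Q := by rw [hQR]; ring
      omega
    have : FiniteDimensional E (degreeLT E N) := (degreeLTEquiv E N).symm.finiteDimensional
    have hker := LinearMap.ker_ne_bot_of_finrank_lt (f := L) hdim
    obtain ⟨a, ha, ha0⟩ := Submodule.exists_mem_ne_zero_of_ne_bot hker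
    exact ⟨a, ha0, congrArg Subtype.val (LinearMap.mem_ker.mp ha)⟩
  let b : ι → E := fun v => (a v) ^ Q
  have hb : ∀ v, b v ^ Q = a v := fun v => hxQ _
  have hb0 : ∃ v, b v ≠ 0 := by
    obtain ⟨v, hv⟩ := Function.ne_iff.mp ha0
    exact ⟨v, pow_ne_zero _ hv⟩
  have hGdeg : ∀ v, (G v).natDegree = v.1.1 + R * (p * v.2.1.1 + e * v.2.2.1) + m * R * (p - 1) := by
    rintro ⟨i, i', j⟩
    have hj : p - 1 = j.1 + (p - 1 - j.1) := by have := j.2; omega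
    simp only [G]
    rw [natDegree_mul (by simp) (by simp [hT0]), natDegree_mul (by simp [hT0]) (by simp),
      natDegree_X_pow, natDegree_X_pow, natDegree_pow, hTdeg]
    conv_rhs => rw [hj]
    rw [hQR]
    ring
  have hGinj : ∀ v w, (G v).natDegree = (G w).natDegree → v = w := by
    rintro ⟨i, i', j⟩ ⟨k, k', l⟩ h
    rw [hGdeg, hGdeg] at h
    have h := Nat.add_right_cancel h
    have hik : i.1 = k.1 := by
      have := congrArg (· % R) h
      simpa [Nat.add_mul_mod_self_left, Nat.mod_eq_of_lt i.2, Nat.mod_eq_of_lt k.2] using this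
    rw [hik] at h
    have h := Nat.eq_of_mul_eq_mul_left hR (Nat.add_left_cancel h)
    have hjl : j.1 = l.1 := by
      have h1 : e * j.1 ≡ e * l.1 [MOD p] := by
        have := congrArg (· % p) h
        simpa [Nat.ModEq] using this
      have h2 := Nat.ModEq.cancel_left_of_coprime
        ((Nat.Prime.coprime_iff_not_dvd hp).mpr hpe) h1
      exact Nat.ModEq.eq_of_lt_of_lt h2 j.2 l.2
    rw [hjl] at h
    have h := Nat.eq_of_mul_eq_mul_left hp.pos (Nat.add_right_cancel h)
    exact Prod.ext (Fin.ext hik) (Prod.ext (Fin.ext h) (Fin.ext hjl))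
  have hG0 : ∑ v, C (b v) * G v ≠ 0 := by
    have hG : ∀ v, G v ≠ 0 := fun v =>
      mul_ne_zero (by simp) (mul_ne_zero (pow_ne_zero _ hT0) (by simp))
    obtain ⟨v₀, hv₀⟩ := hb0
    intro h0
    have hdeg := degree_sum_eq_of_disjoint (fun v => C (b v) * G v) Finset.univ (by
      rintro v ⟨-, hv⟩ w ⟨-, hw⟩ hvw hvw'
      have hv : b v ≠ 0 := by rintro h; simp [h] at hv
      have hw : b w ≠ 0 := by rintro h; simp [h] at hw
      simp only [Function.comp_apply, degree_C_mul hv, degree_C_mul hw] at hvw'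
      exact hvw (hGinj _ _ (natDegree_eq_of_degree_eq hvw')))
    rw [h0, degree_zero, eq_comm, Finset.sup_eq_bot_iff] at hdeg
    have := hdeg v₀ (Finset.mem_univ _)
    rw [degree_eq_bot] at this
    exact mul_ne_zero (C_ne_zero.mpr hv₀) (hG v₀) this
  have hroot : ∀ x ∈ Z, (∑ v, C (b v) * G v).IsRoot x := by
    intro x hx
    have hx0 := (hZ x hx).1
    rw [IsRoot.def, ← pow_eq_zero_iff (n := Q) hQ0.ne']
    have key : (eval x (∑ v, C (b v) * G v)) ^ Q
        = x ^ (m * R * (p - 1) * (Q - 1)) * eval x (∑ v, C (a v) * H v) := by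
      rw [eval_finsetSum, eval_finsetSum, hQdef, sum_pow_char_pow, Finset.mul_sum, ← hQdef]
      refine Finset.sum_congr rfl ?_
      rintro ⟨i, i', j⟩ -
      have hj : p - 1 = j.1 + (p - 1 - j.1) := by have := j.2; omega
      have hQ1 : Q = (Q - 1) + 1 := (Nat.sub_add_cancel hQ0).symm
      simp only [G, H, eval_mul, eval_C, eval_pow, eval_X, eval_sub, hTt x hx0]
      have e2 : c * x ^ (m * R) - x ^ (m * R) * t x = x ^ (m * R) * (t x) ^ Q := by
        rw [htt x hx]; ring
      have e3 : (x ^ (i.1 + i'.1 * Q)) ^ Q = x ^ (i.1 * Q + i'.1) := by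
        rw [pow_add, mul_pow, pow_mul x i'.1 Q, hxQ, ← pow_mul, pow_add]
      rw [e2, mul_pow, mul_pow, hb, e3]
      have e5 : ((x ^ (m * R) * t x) ^ j.1 * x ^ (m * R * (p - 1 - j.1))) ^ Q
          = x ^ (m * R * (p - 1) * Q) * (t x ^ Q) ^ j.1 := by
        rw [mul_pow, mul_pow, mul_pow, ← pow_mul, ← pow_mul, ← pow_mul, ← pow_mul, ← pow_mul,
          mul_right_comm, ← pow_add, mul_comm j.1 Q]
        congr 2
        conv_rhs => rw [hj]
        ring
      have e6 : (x ^ (m * R) * t x ^ Q) ^ j.1 * x ^ (m * R * (p - 1 - j.1))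
          = x ^ (m * R * (p - 1)) * (t x ^ Q) ^ j.1 := by
        rw [mul_pow, mul_right_comm, ← pow_mul, ← pow_add]
        congr 2
        conv_rhs => rw [hj]
        ring
      rw [e5, e6]
      have e7 : x ^ (m * R * (p - 1) * Q)
          = x ^ (m * R * (p - 1) * (Q - 1)) * x ^ (m * R * (p - 1)) := by
        rw [← pow_add]
        congr 1
        conv_lhs => rw [hQ1]
        ring
      rw [e7]
      ring
    rw [key, haH, eval_zero, mul_zero]
  calc Z.card ≤ (∑ v, C (b v) * G v).natDegree := by
        refine Polynomial.card_le_degree_of_subset_roots ?_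
        intro x hx
        exact (mem_roots hG0).mpr (hroot x hx)
    _ ≤ _ := by
        refine natDegree_sum_le_of_forall_le _ _ fun v _ => (natDegree_C_mul_le _ _).trans ?_
        obtain ⟨i, i', j⟩ := v
        rw [hGdeg]
        have hi : i.1 + 1 ≤ R := i.2
        have hi' : i'.1 ≤ R + (m + e) := Nat.lt_succ_iff.mp i'.2
        have hj : j.1 ≤ p - 1 := Nat.le_sub_one_of_lt j.2
        have h1 : R * (p * i'.1 + e * j.1) ≤ R * (p * (R + (m + e)) + e * (p - 1)) := by gcongr
        have h2 : R * (p * (R + (m + e)) + e * (p - 1)) + m * R * (p - 1) + (m + e) * R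
            = Q * R + 2 * (m + e) * Q := by
          obtain ⟨r, hr⟩ := Nat.exists_eq_add_of_le hp.one_le
          rw [hQR, hr, Nat.add_sub_cancel_left]
          ring
        have h3 : R ≤ Q := by rw [hQR]; exact Nat.le_mul_of_pos_left _ hp.pos
        nlinarith

open Finset in
theorem norm_sum_addChar_trace_le {E : Type*} [Field E] [Fintype E] [DecidableEq E] {p s m e : ℕ}
    [Fact p.Prime] [Algebra (ZMod p) E] (hE : Module.finrank (ZMod p) E = 2 * (s + 1)) (he : 0 < e)
    (hpe : ¬ p ∣ e) {P : Polynomial E} (hP : P.natDegree = m + e)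
    {ψ : AddChar (ZMod p) ℂ} (hψ : ψ ≠ 1) :
    ‖∑ x ∈ univ.filter (fun x : E => x ≠ 0),
        ψ (Algebra.trace (ZMod p) E (P.eval x / x ^ m))‖
      ≤ (p * (p * (2 * (m + e) + 1)) : ℕ) * (p : ℝ) ^ (s + 1) := by
  have hp : p.Prime := Fact.out
  have : CharP E p := charP_of_injective_algebraMap (algebraMap (ZMod p) E).injective p
  have hcard : Fintype.card E = p ^ (2 * (s + 1)) := by
    rw [Module.card_eq_pow_finrank (K := ZMod p), hE, ZMod.card]
  set X := univ.filter (fun x : E => x ≠ 0) with hX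
  set g : E → ZMod p := fun x => Algebra.trace (ZMod p) E (P.eval x / x ^ m) with hg
  set Q := p ^ (s + 1) with hQ
  set R := p ^ s with hR
  set C := 2 * (m + e) + 1 with hC
  have hQ0 : 0 < Q := pow_pos hp.pos _
  let N : ZMod p → ℕ := fun c => (X.filter (fun x => g x = c)).card
  have hN : ∀ c, N c ≤ Q * R + C * Q := by
    intro c
    refine card_trace_fiber_le (P := P) hcard he hpe hP (c := algebraMap (ZMod p) E c) _ ?_
    intro x hx
    rw [mem_filter, hX, mem_filter] at hx
    refine ⟨hx.1.2, ?_⟩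
    rw [← hx.2, hg, FiniteField.algebraMap_trace_eq_sum_pow, hE, Nat.card_zmod]
  have hsum : ∑ c, N c = Q * R * p - 1 := by
    rw [← card_eq_sum_card_fiberwise (fun x _ => mem_univ (g x)), hX, filter_ne', card_erase_of_mem (mem_univ _),
      card_univ, hcard]
    congr 1
    rw [hQ, hR]
    ring
  have hpos : 0 < Q * R * p := Nat.mul_pos (Nat.mul_pos hQ0 (pow_pos hp.pos _)) hp.pos
  have hNlow : ∀ c, Q * R ≤ N c + p * (C * Q) := by
    intro c
    have h1 : ∑ d ∈ univ.erase c, N d ≤ (p - 1) * (Q * R + C * Q) := by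
      refine (sum_le_card_nsmul _ _ _ fun d _ => hN d).trans ?_
      rw [card_erase_of_mem (mem_univ _), card_univ, ZMod.card, smul_eq_mul]
    have h2 := add_sum_erase univ N (mem_univ c)
    obtain ⟨r, hr⟩ := Nat.exists_eq_add_of_le hp.one_le
    rw [hsum] at h2
    have hr' : p - 1 = r := by omega
    rw [hr'] at h1
    have h3 : N c + ∑ d ∈ univ.erase c, N d + 1 = Q * R * p := by omega
    have h4 : 0 < C * Q := Nat.mul_pos (by omega) hQ0
    have h5 : Q * R * p = Q * R + Q * R * r := by
      conv_lhs => rw [hr]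
      ring
    have h6 : p * (C * Q) = C * Q + r * (C * Q) := by
      conv_lhs => rw [hr]
      ring
    have h7 : r * (Q * R + C * Q) = Q * R * r + r * (C * Q) := by ring
    omega
  have habs : ∀ c, |(N c : ℝ) - (Q * R : ℕ)| ≤ (p * (C * Q) : ℕ) := by
    intro c
    have h1 : (Q * R : ℕ) ≤ (N c : ℝ) + (p * (C * Q) : ℕ) := by exact_mod_cast hNlow c
    have h2 : (N c : ℝ) ≤ (Q * R : ℕ) + (p * (C * Q) : ℕ) := by
      exact_mod_cast (hN c).trans (Nat.add_le_add_left (Nat.le_mul_of_pos_left _ hp.pos) _)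
    rw [abs_le]
    constructor <;> linarith
  have hS : ∑ x ∈ X, ψ (g x) = ∑ c, (((N c : ℝ) - (Q * R : ℕ) : ℝ) : ℂ) * ψ c := by
    have h0 : ∑ c, ψ c = 0 := AddChar.sum_eq_zero_of_ne_one hψ
    push_cast
    simp only [sub_mul, sum_sub_distrib, ← mul_sum, h0, mul_zero, sub_zero]
    rw [← sum_fiberwise X g]
    refine sum_congr rfl fun c _ => ?_
    rw [sum_congr rfl (g := fun _ => ψ c) (fun x hx => by rw [(mem_filter.mp hx).2]), sum_const,
      nsmul_eq_mul]
  rw [hS]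
  refine (norm_sum_le_of_le _ (f := _) (n := fun _ => ((p * (C * Q) : ℕ) : ℝ)) fun c _ => ?_).trans ?_
  · rw [norm_mul, AddChar.norm_apply, mul_one, Complex.norm_real]
    exact habs c
  · rw [sum_const, card_univ, ZMod.card, nsmul_eq_mul, hQ]
    push_cast
    apply le_of_eq
    ring

open Polynomial in
/-- The finite set of monic polynomials of degree `d` over a finite field. -/
noncomputable def monicsOfDegree (F : Type*) [Field F] [Fintype F] (d : ℕ) : Finset F[X] := by
  classical
  exact Finset.univ.image fun a : Fin d → F => X ^ d + ∑ i, C (a i) * X ^ (i : ℕ)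

open Polynomial in
theorem mem_monicsOfDegree {F : Type*} [Field F] [Fintype F] {d : ℕ} {h : F[X]} :
    h ∈ monicsOfDegree F d ↔ h.Monic ∧ h.natDegree = d := by
  classical
  simp only [monicsOfDegree, Finset.mem_image, Finset.mem_univ, true_and]
  constructor
  · rintro ⟨a, rfl⟩
    have hdeg := degree_sum_fin_lt a
    refine ⟨monic_X_pow_add hdeg, ?_⟩
    rw [natDegree_add_eq_left_of_degree_lt (by rwa [degree_X_pow]), natDegree_X_pow]
  · rintro ⟨hm, rfl⟩
    refine ⟨fun i => h.coeff i, ?_⟩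
    conv_rhs => rw [hm.as_sum]
    rw [Fin.sum_univ_eq_sum_range (fun i => C (h.coeff i) * X ^ i)]

open Polynomial in
/-- The monic irreducible polynomials whose degree divides `r`. -/
noncomputable def irreducibleFactors (F : Type*) [Field F] [Fintype F] (r : ℕ) : Finset F[X] := by
  classical
  exact ((Finset.range (r + 1)).biUnion (monicsOfDegree F)).filter
    fun P => Irreducible P ∧ P.natDegree ∣ r

open Polynomial in
theorem mem_irreducibleFactors {F : Type*} [Field F] [Fintype F] {r : ℕ} (hr : 0 < r) {P : F[X]} :
    P ∈ irreducibleFactors F r ↔ P.Monic ∧ Irreducible P ∧ P.natDegree ∣ r := by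
  classical
  simp only [irreducibleFactors, Finset.mem_filter, Finset.mem_biUnion, mem_monicsOfDegree,
    Finset.mem_range]
  constructor
  · rintro ⟨⟨d, _, hm, _⟩, h⟩
    exact ⟨hm, h⟩
  · rintro ⟨hm, h⟩
    exact ⟨⟨_, Nat.lt_succ_of_le (Nat.le_of_dvd hr h.2), hm, rfl⟩, h⟩

open Polynomial UniqueFactorizationMonoid Classical in
theorem sum_natDegree_of_pow_dvd {F : Type*} [Field F] [Fintype F] {h : F[X]}
    (hm : h.Monic) :
    ∑ r ∈ Finset.Icc 1 h.natDegree, ∑ P ∈ (irreducibleFactors F r).filter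
      (fun P => P ^ (r / P.natDegree) ∣ h), P.natDegree = h.natDegree := by
  classical
  have h0 : h ≠ 0 := hm.ne_zero
  set W := normalizedFactors h with hW
  have hWm : ∀ P ∈ W, P.Monic ∧ Irreducible P := fun P hP =>
    ⟨by
      rw [← normalize_normalized_factor P hP]
      exact monic_normalize (irreducible_of_normalized_factor P hP).ne_zero,
      irreducible_of_normalized_factor P hP⟩
  have hprod : W.prod = h := by
    have := prod_normalizedFactors h0
    refine eq_of_monic_of_associated ?_ hm this
    simpa using monic_multiset_prod_of_monic W id fun P hP => (hWm P hP).1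
  have hdvd : ∀ {P : F[X]}, P.Monic → Irreducible P → ∀ j, P ^ j ∣ h ↔ j ≤ W.count P := by
    intro P hP hPi j
    rw [pow_dvd_iff_le_emultiplicity, emultiplicity_eq_count_normalizedFactors hPi h0,
      hP.normalize_eq_self, Nat.cast_le]
  have hdeg : ∑ P ∈ W.toFinset, W.count P * P.natDegree = h.natDegree := by
    conv_rhs => rw [← hprod, natDegree_multiset_prod_of_monic W (fun P hP => (hWm P hP).1),
      ← Multiset.map_id' W]
    rw [Finset.sum_multiset_map_count]
    simp
  have hfil : ∀ r ∈ Finset.Icc 1 h.natDegree,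
      (irreducibleFactors F r).filter (fun P => P ^ (r / P.natDegree) ∣ h)
        = W.toFinset.filter (fun P => P.natDegree ∣ r ∧ r / P.natDegree ≤ W.count P) := by
    intro r hr
    rw [Finset.mem_Icc] at hr
    ext P
    rw [Finset.mem_filter, Finset.mem_filter, mem_irreducibleFactors hr.1, Multiset.mem_toFinset]
    constructor
    · rintro ⟨⟨hP, hPi, hr'⟩, hd⟩
      rw [hdvd hP hPi] at hd
      refine ⟨Multiset.count_pos.mp (lt_of_lt_of_le ?_ hd), hr', hd⟩
      exact Nat.div_pos (Nat.le_of_dvd hr.1 hr') hPi.natDegree_pos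
    · rintro ⟨hP, hr', hd⟩
      obtain ⟨hP, hPi⟩ := hWm P hP
      exact ⟨⟨hP, hPi, hr'⟩, (hdvd hP hPi _).mpr hd⟩
  rw [Finset.sum_congr rfl fun r hr => by rw [hfil r hr]]
  simp only [Finset.sum_filter]
  rw [Finset.sum_comm]
  conv_rhs => rw [← hdeg]
  refine Finset.sum_congr rfl fun P hP => ?_
  obtain ⟨-, hPi⟩ := hWm P (Multiset.mem_toFinset.mp hP)
  have hpos := hPi.natDegree_pos
  have hle : W.count P * P.natDegree ≤ h.natDegree := by
    rw [← hdeg]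
    exact Finset.single_le_sum (f := fun P => W.count P * P.natDegree) (fun _ _ => Nat.zero_le _) hP
  rw [← Finset.sum_filter, Finset.sum_const, smul_eq_mul]
  congr 1
  have : (Finset.Icc 1 h.natDegree).filter
      (fun r => P.natDegree ∣ r ∧ r / P.natDegree ≤ W.count P)
      = (Finset.Icc 1 (W.count P)).image (· * P.natDegree) := by
    ext r
    simp only [Finset.mem_filter, Finset.mem_Icc, Finset.mem_image]
    constructor
    · rintro ⟨⟨h1, h2⟩, h3, h4⟩
      exact ⟨r / P.natDegree, ⟨Nat.div_pos (Nat.le_of_dvd h1 h3) hpos, h4⟩, Nat.div_mul_cancel h3⟩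
    · rintro ⟨j, ⟨h1, h2⟩, rfl⟩
      refine ⟨⟨Nat.mul_pos h1 hpos, (Nat.mul_le_mul_right _ h2).trans hle⟩, dvd_mul_left _ _, ?_⟩
      rwa [Nat.mul_div_cancel _ hpos]
  rw [this, Finset.card_image_of_injective _ (fun _ _ h => Nat.eq_of_mul_eq_mul_right hpos h), Nat.card_Icc,
    Nat.add_sub_cancel]

open Polynomial Classical in
theorem sum_pow_dvd {F : Type*} [Field F] [Fintype F] {lam : F[X] → ℂ}
    (hmul : ∀ g h : F[X], g.Monic → h.Monic → lam (g * h) = lam g * lam h) (h1 : lam 1 = 1)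
    {P : F[X]} (hP : P.Monic) {j d : ℕ} (hj : j * P.natDegree ≤ d) :
    ∑ h ∈ (monicsOfDegree F d).filter (fun h => P ^ j ∣ h), lam h
      = lam P ^ j * ∑ h ∈ monicsOfDegree F (d - j * P.natDegree), lam h := by
  have hpow : ∀ j, lam (P ^ j) = lam P ^ j := by
    intro j
    induction j with
    | zero => simpa using h1
    | succ j ih => rw [pow_succ, hmul _ _ (hP.pow j) hP, ih, pow_succ]
  rw [Finset.mul_sum]
  symm
  refine Finset.sum_bij (fun h _ => P ^ j * h) ?_ ?_ ?_ ?_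
  · intro h hh
    rw [mem_monicsOfDegree] at hh
    rw [Finset.mem_filter, mem_monicsOfDegree]
    refine ⟨⟨(hP.pow j).mul hh.1, ?_⟩, dvd_mul_right _ _⟩
    rw [(hP.pow j).natDegree_mul hh.1, hP.natDegree_pow, hh.2]
    omega
  · intro a _ b _ hab
    exact mul_left_cancel₀ (hP.pow j).ne_zero hab
  · intro h hh
    rw [Finset.mem_filter, mem_monicsOfDegree] at hh
    obtain ⟨⟨hm, hd⟩, g, rfl⟩ := hh
    have hg : g.Monic := (hP.pow j).of_mul_monic_left hm
    refine ⟨g, ?_, rfl⟩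
    rw [mem_monicsOfDegree]
    refine ⟨hg, ?_⟩
    rw [(hP.pow j).natDegree_mul hg, hP.natDegree_pow] at hd
    omega
  · intro h hh
    rw [mem_monicsOfDegree] at hh
    rw [hmul _ _ (hP.pow j) hh.1, hpow]

open Polynomial in
theorem natDegree_mul_sum_monicsOfDegree {F : Type*} [Field F] [Fintype F] {lam : F[X] → ℂ}
    (hmul : ∀ g h : F[X], g.Monic → h.Monic → lam (g * h) = lam g * lam h) (h1 : lam 1 = 1)
    (d : ℕ) :
    d * ∑ h ∈ monicsOfDegree F d, lam h = ∑ r ∈ Finset.Icc 1 d,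
      (∑ P ∈ irreducibleFactors F r, P.natDegree * lam P ^ (r / P.natDegree)) *
        ∑ h ∈ monicsOfDegree F (d - r), lam h := by
  classical
  have hR : ∀ r ∈ Finset.Icc 1 d,
      (∑ P ∈ irreducibleFactors F r, P.natDegree * lam P ^ (r / P.natDegree)) *
        ∑ h ∈ monicsOfDegree F (d - r), lam h
      = ∑ h ∈ monicsOfDegree F d, (∑ P ∈ (irreducibleFactors F r).filter
          (fun P => P ^ (r / P.natDegree) ∣ h), P.natDegree : ℕ) * lam h := by
    intro r hr
    rw [Finset.mem_Icc] at hr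
    rw [Finset.sum_mul]
    simp only [Finset.sum_filter, Nat.cast_sum, Finset.sum_mul]
    rw [Finset.sum_comm]
    refine Finset.sum_congr rfl fun P hP => ?_
    rw [mem_irreducibleFactors hr.1] at hP
    have hdiv := Nat.div_mul_cancel hP.2.2
    have := sum_pow_dvd hmul h1 hP.1 (j := r / P.natDegree) (d := d) (by omega)
    rw [hdiv] at this
    rw [mul_assoc, ← this, Finset.sum_filter, Finset.mul_sum]
    refine Finset.sum_congr rfl fun h _ => ?_
    split_ifs <;> simp
  rw [Finset.sum_congr rfl hR, Finset.sum_comm, Finset.mul_sum]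
  refine Finset.sum_congr rfl fun h hh => ?_
  rw [mem_monicsOfDegree] at hh
  rw [← Finset.sum_mul, ← Nat.cast_sum]
  congr 2
  conv_lhs => rw [← hh.2, ← sum_natDegree_of_pow_dvd hh.1, hh.2]

open PowerSeries in
theorem X_mul_derivative_prod_one_sub (s : Multiset ℂ) :
    X * derivative ℂ ((s.map fun w => (1 - C w * X : ℂ⟦X⟧)).prod)
      = -(PowerSeries.mk fun r => if r = 0 then 0 else (s.map (· ^ r)).sum)
        * (s.map fun w => (1 - C w * X : ℂ⟦X⟧)).prod := by
  induction s using Multiset.induction with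
  | empty =>
    have : (PowerSeries.mk fun _ => (0 : ℂ)) = 0 := by ext; simp
    simpa using this
  | cons w s ih =>
    have h1 : (PowerSeries.mk fun r => if r = 0 then (0 : ℂ) else w ^ r) * (1 - C w * X)
        = C w * X := by
      ext n
      rw [mul_sub, mul_one, map_sub, ← mul_assoc, mul_comm _ (C w), mul_assoc, coeff_C_mul, coeff_C_mul]
      rcases n with _ | n
      · simp
      · rw [coeff_succ_mul_X, coeff_X, coeff_mk, coeff_mk]
        rcases n with _ | n
        · simp
        · simp [pow_succ]; ring
    have h2 : (PowerSeries.mk fun r => if r = 0 then (0 : ℂ) else ((w ::ₘ s).map (· ^ r)).sum)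
        = (PowerSeries.mk fun r => if r = 0 then (0 : ℂ) else w ^ r)
          + PowerSeries.mk fun r => if r = 0 then (0 : ℂ) else (s.map (· ^ r)).sum := by
      ext n
      simp only [map_add, coeff_mk]
      split_ifs <;> simp
    rw [h2, Multiset.map_cons, Multiset.prod_cons, Derivation.leibniz, mul_add, smul_eq_mul, smul_eq_mul]
    have h3 : derivative ℂ (1 - C w * X : ℂ⟦X⟧) = - C w := by
      simp [derivative_C]
    rw [h3, mul_left_comm, ih]
    linear_combination ((s.map fun w => (1 - C w * X : ℂ⟦X⟧)).prod) * h1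

open Polynomial in
theorem exists_powerSums_of_recurrence {D : ℕ} {L Λ : ℕ → ℂ} (h0 : L 0 = 1)
    (hL : ∀ d, D < d → L d = 0)
    (hrec : ∀ d : ℕ, d * L d = ∑ r ∈ Finset.Icc 1 d, Λ r * L (d - r)) :
    ∃ s : Multiset ℂ, s.card ≤ D ∧ ∀ r, 0 < r → Λ r = -(s.map (· ^ r)).sum := by
  let f : ℂ[X] := ∑ d ∈ Finset.range (D + 1), C (L d) * X ^ d
  have hf : ∀ d, f.coeff d = L d := by
    intro d
    simp only [f, finsetSum_coeff, coeff_C_mul_X_pow, Finset.sum_ite_eq, Finset.mem_range]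
    split_ifs with h
    · rfl
    · exact (hL d (by omega)).symm
  have hfdeg : f.natDegree ≤ D := by
    rw [natDegree_le_iff_coeff_eq_zero]
    intro d hd
    rw [hf, hL d hd]
  have hf0 : f.eval 0 = 1 := by rw [← coeff_zero_eq_eval_zero, hf, h0]
  have hfne : f ≠ 0 := by rintro h; simp [h] at hf0
  have hprod : f = (f.roots.map fun a => 1 - C a⁻¹ * X).prod := by
    have h1 := (IsAlgClosed.splits f).eq_prod_roots
    have h2 : (f.roots.map fun a => X - C a) = f.roots.map fun a => C (-a) * (1 - C a⁻¹ * X) := by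
      refine Multiset.map_congr rfl fun a ha => ?_
      have ha0 : a ≠ 0 := by
        rintro rfl
        rw [mem_roots hfne, IsRoot.def, hf0] at ha
        exact one_ne_zero ha
      rw [mul_sub, ← mul_assoc, ← C_mul, neg_mul, mul_inv_cancel₀ ha0]
      simp
      ring
    rw [h2, Multiset.prod_map_mul, ← mul_assoc] at h1
    have h3 : C f.leadingCoeff * (f.roots.map fun a => C (-a)).prod
        = C (f.leadingCoeff * (f.roots.map fun a => -a).prod) := by
      rw [C_mul, map_multiset_prod, Multiset.map_map]
      rfl
    rw [h3] at h1
    have h4 := congrArg (eval 0) h1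
    rw [hf0, eval_mul, eval_C, eval_multiset_prod, Multiset.map_map] at h4
    simp only [Function.comp_def, eval_sub, eval_one, eval_mul, eval_C, eval_X, mul_zero, sub_zero,
      Multiset.map_const', Multiset.prod_replicate, one_pow, mul_one] at h4
    rwa [← h4, C_1, one_mul] at h1
  refine ⟨f.roots.map (·⁻¹), ?_, ?_⟩
  · rw [Multiset.card_map]
    exact (card_roots' f).trans hfdeg
  set s := f.roots.map (·⁻¹) with hs
  have hfs : (f : PowerSeries ℂ) = (s.map fun w => (1 - PowerSeries.C w * PowerSeries.X)).prod := by
    conv_lhs => rw [hprod]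
    rw [hs, Multiset.map_map, ← coeToPowerSeries.ringHom_apply, map_multiset_prod, Multiset.map_map]
    congr 1
    refine Multiset.map_congr rfl fun a _ => ?_
    simp
  have h1 := X_mul_derivative_prod_one_sub s
  rw [← hfs] at h1
  have h2 : PowerSeries.X * PowerSeries.derivative ℂ (f : PowerSeries ℂ)
      = (PowerSeries.mk fun r => if r = 0 then 0 else Λ r) * (f : PowerSeries ℂ) := by
    ext d
    conv_rhs => rw [PowerSeries.coeff_mul]
    rw [Finset.Nat.sum_antidiagonal_eq_sum_range_succ
      (fun i j => PowerSeries.coeff i (PowerSeries.mk fun r => if r = 0 then 0 else Λ r) *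
        PowerSeries.coeff j (f : PowerSeries ℂ))]
    rw [Finset.sum_range_succ']
    simp only [PowerSeries.coeff_mk, Polynomial.coeff_coe, hf]
    have h3 := hrec d
    rw [Finset.range_eq_Ico, Finset.sum_Ico_add' (fun i => (if i = 0 then 0 else Λ i) * L (d - i))]
    have h4 : Finset.Ico (0 + 1) (d + 1) = Finset.Icc 1 d := by ext; simp
    rw [h4]
    rw [Finset.sum_congr rfl (g := fun i => Λ i * L (d - i)) (fun i hi => by
      rw [if_neg]; have := (Finset.mem_Icc.mp hi).1; omega), ← h3]
    rcases d with _ | d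
    · simp
    · rw [PowerSeries.coeff_succ_X_mul, PowerSeries.coeff_derivative]
      simp [hf]
      ring
  have hfne' : (f : PowerSeries ℂ) ≠ 0 := by
    rw [Ne, Polynomial.coe_eq_zero_iff]; exact hfne
  have h5 := mul_right_cancel₀ hfne' (h2.symm.trans h1)
  intro r hr
  have := congrArg (PowerSeries.coeff r) h5
  simpa [hr.ne'] using this

theorem sum_irreducibleFactors_eq_sum_minpoly {F E : Type*} [Field F] [Fintype F] [Field E]
    [Fintype E] [Algebra F E] (g : Polynomial F → ℂ) :
    ∑ P ∈ irreducibleFactors F (Module.finrank F E), P.natDegree * g P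
      = ∑ x : E, g (minpoly F x) := by
  classical
  have hr : 0 < Module.finrank F E := Module.finrank_pos
  rw [← Finset.sum_fiberwise_of_maps_to (s := Finset.univ) (g := fun x : E => minpoly F x)
    (t := irreducibleFactors F (Module.finrank F E))]
  · refine Finset.sum_congr rfl fun P hP => ?_
    rw [mem_irreducibleFactors hr] at hP
    obtain ⟨hm, hi, hd⟩ := hP
    rw [Finset.sum_congr rfl (g := fun _ => g P) (fun x hx => by
      rw [(Finset.mem_filter.mp hx).2]), Finset.sum_const, nsmul_eq_mul]
    congr 2
    have hsplit : (P.map (algebraMap F E)).Splits := by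
      have h1 := hi.natDegree_dvd_iff_dvd_X_pow_card_pow_sub_X.mp hd
      rw [← Module.natCard_eq_pow_finrank (K := F) (V := E)] at h1
      rw [Nat.card_eq_fintype_card] at h1
      refine (FiniteField.isSplittingField_sub E F).splits.of_dvd ?_ (Polynomial.map_dvd _ h1)
      exact Polynomial.map_ne_zero (FiniteField.X_pow_card_sub_X_ne_zero _ Fintype.one_lt_card)
    rw [← Polynomial.card_rootSet_eq_natDegree (PerfectField.separable_of_irreducible hi) hsplit,
      ← Set.toFinset_card]
    congr 1
    ext x
    rw [Set.mem_toFinset, Polynomial.mem_rootSet_of_ne hi.ne_zero, Finset.mem_filter]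
    constructor
    · intro h
      exact ⟨Finset.mem_univ _, (minpoly.eq_of_irreducible_of_monic hi h hm).symm⟩
    · rintro ⟨-, rfl⟩
      exact minpoly.aeval F x
  · intro x _
    have hx : IsIntegral F x := Algebra.IsIntegral.isIntegral x
    rw [mem_irreducibleFactors hr]
    exact ⟨minpoly.monic hx, minpoly.irreducible hx, minpoly.degree_dvd hx⟩

theorem sum_algEquiv_eq_sum_aroots_minpoly {F E M : Type*} [Field F] [Field E] [Algebra F E]
    [FiniteDimensional F E] [IsGalois F E] [AddCommMonoid M] (φ : E → M) (x : E) :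
    ∑ σ : Gal(E/F), φ (σ x) = (Module.finrank F E / (minpoly F x).natDegree) •
      (((minpoly F x).aroots E).map φ).sum := by
  classical
  have hx : IsIntegral F x := Algebra.IsIntegral.isIntegral x
  have hne := minpoly.ne_zero hx
  have hnodup : ((minpoly F x).aroots E).Nodup :=
    Polynomial.nodup_roots (Polynomial.Separable.map (Algebra.IsSeparable.isSeparable F x))
  let S : Finset E := ⟨(minpoly F x).aroots E, hnodup⟩
  have hS : S.card = (minpoly F x).natDegree := by
    rw [← Polynomial.natDegree_map (algebraMap F E)]
    exact (IsGalois.splits F x).natDegree_eq_card_roots.symm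
  have hmaps : ∀ σ ∈ (Finset.univ : Finset Gal(E/F)), σ x ∈ S := by
    intro σ _
    change σ x ∈ (minpoly F x).aroots E
    rw [Polynomial.mem_aroots]
    refine ⟨hne, ?_⟩
    rw [Polynomial.aeval_algHom_apply, minpoly.aeval, map_zero]
  have hfib : ∀ y ∈ S, (Finset.univ.filter fun σ : Gal(E/F) => σ x = y).card
      = (Finset.univ.filter fun σ : Gal(E/F) => σ x = x).card := by
    intro y hy
    change y ∈ (minpoly F x).aroots E at hy
    rw [Polynomial.mem_aroots] at hy
    obtain ⟨τ, hτ⟩ := minpoly.exists_algEquiv_of_root' (Algebra.IsAlgebraic.isAlgebraic x) hy.2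
    symm
    refine Finset.card_bij (fun σ _ => τ * σ) ?_ ?_ ?_
    · intro σ hσ
      have h := (Finset.mem_filter.mp hσ).2
      simp [h, hτ]
    · intro a _ b _ h
      exact mul_left_cancel h
    · intro σ hσ
      have h := (Finset.mem_filter.mp hσ).2
      refine ⟨τ⁻¹ * σ, ?_, by simp⟩
      simp [h, ← hτ]
  set c := (Finset.univ.filter fun σ : Gal(E/F) => σ x = x).card with hc
  have hcard : Module.finrank F E = (minpoly F x).natDegree * c := by
    rw [← IsGalois.card_aut_eq_finrank, Nat.card_eq_fintype_card, ← Finset.card_univ,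
      Finset.card_eq_sum_card_fiberwise hmaps, Finset.sum_congr rfl hfib, Finset.sum_const, hS, smul_eq_mul]
  rw [hcard, Nat.mul_div_cancel_left _ (minpoly.natDegree_pos hx),
    ← Finset.sum_fiberwise_of_maps_to hmaps]
  change _ = c • ∑ y ∈ S, φ y
  rw [Finset.smul_sum]
  refine Finset.sum_congr rfl fun y hy => ?_
  rw [Finset.sum_congr rfl (g := fun _ => φ y) (fun σ hσ => by
      rw [(Finset.mem_filter.mp hσ).2]), Finset.sum_const, hfib y hy]

open PowerSeries in
/-- The `j`-th coefficient of `-X g' / g`. For `g = ∏ (1 - yᵢ X)` and `0 < j` this is the power sum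
`∑ yᵢ ^ j`. -/
noncomputable def logDerivCoeff {F : Type*} [Field F] (g : PowerSeries F) (j : ℕ) : F :=
  -coeff j (X * derivative F g * g⁻¹)

section
variable {F : Type*} [Field F]
open PowerSeries

theorem logDerivCoeff_mul {g h : PowerSeries F} (hg : constantCoeff g ≠ 0)
    (hh : constantCoeff h ≠ 0) (j : ℕ) :
    logDerivCoeff (g * h) j = logDerivCoeff g j + logDerivCoeff h j := by
  rw [logDerivCoeff, logDerivCoeff, logDerivCoeff, ← neg_add, ← map_add, Derivation.leibniz,
    PowerSeries.mul_inv_rev, smul_eq_mul, smul_eq_mul]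
  congr 2
  have h1 := PowerSeries.mul_inv_cancel g hg
  have h2 := PowerSeries.mul_inv_cancel h hh
  linear_combination (X * derivative F h * h⁻¹) * h1 + (X * derivative F g * g⁻¹) * h2

theorem logDerivCoeff_one (j : ℕ) : logDerivCoeff (1 : PowerSeries F) j = 0 := by
  simp [logDerivCoeff]

theorem logDerivCoeff_C_mul {c : F} (hc : c ≠ 0) {g : PowerSeries F} (hg : constantCoeff g ≠ 0)
    (j : ℕ) : logDerivCoeff (C c * g) j = logDerivCoeff g j := by
  rw [logDerivCoeff_mul (by simpa using hc) hg, add_eq_right]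
  simp [logDerivCoeff, derivative_C]

theorem logDerivCoeff_one_sub (y : F) {j : ℕ} (hj : 0 < j) :
    logDerivCoeff (1 - C y * X : PowerSeries F) j = y ^ j := by
  have h1 : (1 - C y * X : PowerSeries F)⁻¹ = PowerSeries.mk (y ^ ·) := by
    rw [PowerSeries.inv_eq_iff_mul_eq_one (by simp)]
    ext n
    rw [mul_sub, mul_one, map_sub, ← mul_assoc, mul_comm _ (C y), mul_assoc, coeff_C_mul]
    rcases n with _ | n
    · simp
    · rw [coeff_succ_mul_X]
      simp [pow_succ', coeff_one]
  have h2 : derivative F (1 - C y * X : PowerSeries F) = -C y := by simp [derivative_C]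
  obtain ⟨j, rfl⟩ := Nat.exists_eq_add_of_le' hj
  rw [logDerivCoeff, h1, h2, mul_assoc, coeff_succ_X_mul, neg_mul, map_neg, neg_neg, coeff_C_mul,
    coeff_mk, pow_succ']

theorem logDerivCoeff_multiset_prod (s : Multiset F) {j : ℕ} (hj : 0 < j) :
    constantCoeff (s.map fun y => (1 - C y * X : PowerSeries F)).prod = 1 ∧
    logDerivCoeff (s.map fun y => (1 - C y * X : PowerSeries F)).prod j = (s.map (· ^ j)).sum := by
  induction s using Multiset.induction with
  | empty => simp [logDerivCoeff_one]
  | cons y s ih =>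
    rw [Multiset.map_cons, Multiset.map_cons, Multiset.prod_cons, Multiset.sum_cons,
      logDerivCoeff_mul (by simp) (by rw [ih.1]; exact one_ne_zero), logDerivCoeff_one_sub y hj, ih.2]
    exact ⟨by rw [map_mul, ih.1]; simp, rfl⟩

theorem logDerivCoeff_map {E : Type*} [Field E] (f : F →+* E) (g : PowerSeries F)
    (hg : constantCoeff g ≠ 0) (j : ℕ) :
    logDerivCoeff (PowerSeries.map f g) j = f (logDerivCoeff g j) := by
  have h1 : (PowerSeries.map f g)⁻¹ = PowerSeries.map f g⁻¹ := by
    have hg' : constantCoeff (PowerSeries.map f g) ≠ 0 := by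
      rw [← coeff_zero_eq_constantCoeff_apply, PowerSeries.coeff_map, coeff_zero_eq_constantCoeff_apply]
      exact (_root_.map_ne_zero f).mpr hg
    rw [PowerSeries.inv_eq_iff_mul_eq_one hg', ← map_mul,
      PowerSeries.inv_mul_cancel g hg, map_one]
  have h2 : derivative E (PowerSeries.map f g) = PowerSeries.map f (derivative F g) := by
    ext n
    simp [coeff_derivative]
  rw [logDerivCoeff, logDerivCoeff, h1, h2, map_neg, ← PowerSeries.coeff_map, map_mul (PowerSeries.map f),
    map_mul (PowerSeries.map f), PowerSeries.map_X]

theorem logDerivCoeff_add {g : PowerSeries F} (hg : constantCoeff g ≠ 0) (t : F) {j k : ℕ} (hk : 0 < k)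
    (hjk : j ≤ k) :
    logDerivCoeff (g + C t * X ^ k) j
      = logDerivCoeff g j - if j = k then k * t / constantCoeff g else 0 := by
  obtain ⟨k, rfl⟩ := Nat.exists_eq_add_of_le' hk
  set w := C t * g⁻¹ with hw
  have h1 : g + C t * X ^ (k + 1) = g * (1 + X ^ (k + 1) * w) := by
    have h := PowerSeries.mul_inv_cancel g hg
    rw [hw]
    linear_combination -(C t * X ^ (k + 1)) * h
  have hu : constantCoeff (1 + X ^ (k + 1) * w) = 1 := by simp
  rw [h1, logDerivCoeff_mul hg (by rw [hu]; exact one_ne_zero), sub_eq_add_neg]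
  congr 1
  have h2 : X * derivative F (1 + X ^ (k + 1) * w) * (1 + X ^ (k + 1) * w)⁻¹
      = X ^ (k + 1) * (((k + 1 : PowerSeries F) * w + X * derivative F w) * (1 + X ^ (k + 1) * w)⁻¹) := by
    rw [map_add, Derivation.leibniz, Derivation.leibniz_pow]
    simp
    ring
  rw [logDerivCoeff, h2, coeff_X_pow_mul']
  rcases hjk.lt_or_eq with h | rfl
  · rw [if_neg (by omega), if_neg (by omega)]
  · rw [if_pos le_rfl, if_pos rfl, Nat.sub_self, coeff_zero_eq_constantCoeff_apply, map_mul,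
      constantCoeff_inv, hu]
    simp [hw]
    ring
end

open Polynomial in
theorem reverse_multiset_prod_X_sub_C {F : Type*} [Field F] (s : Multiset F) :
    (s.map fun y => X - C y).prod.reverse = (s.map fun y => 1 - C y * X).prod := by
  induction s using Multiset.induction with
  | empty =>
    rw [Multiset.map_zero, Multiset.map_zero, Multiset.prod_zero, ← C_1, reverse_C]
  | cons y s ih =>
    rw [Multiset.map_cons, Multiset.prod_cons, reverse_mul_of_domain, ih, Multiset.map_cons,
      Multiset.prod_cons]
    congr 1
    rw [reverse, natDegree_X_sub_C, sub_eq_add_neg, ← C_neg, reflect_add, reflect_C, ← pow_one X,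
      reflect_monomial, revAt_le le_rfl]
    simp
    ring

open Polynomial in
theorem coe_multiset_prod_one_sub {F : Type*} [Field F] (s : Multiset F) :
    (((s.map fun y => 1 - C y * X).prod : F[X]) : PowerSeries F)
      = (s.map fun y => 1 - PowerSeries.C y * PowerSeries.X).prod := by
  rw [← coeToPowerSeries.ringHom_apply, map_multiset_prod, Multiset.map_map]
  congr 1
  refine Multiset.map_congr rfl fun a _ => ?_
  simp

open Polynomial in
theorem constantCoeff_coe_reverse {F : Type*} [Field F] {h : F[X]} (hm : h.Monic) :
    PowerSeries.constantCoeff (h.reverse : PowerSeries F) = 1 := by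
  rw [← PowerSeries.coeff_zero_eq_constantCoeff_apply, Polynomial.coeff_coe, coeff_zero_reverse]
  exact hm

open Polynomial in
theorem constantCoeff_coe' {F : Type*} [Field F] (h : F[X]) :
    PowerSeries.constantCoeff (h : PowerSeries F) = h.coeff 0 := by
  rw [← PowerSeries.coeff_zero_eq_constantCoeff_apply, Polynomial.coeff_coe]

open Polynomial in
theorem nsmul_logDerivCoeff_reverse_minpoly {F E : Type*} [Field F] [Field E] [Algebra F E]
    [FiniteDimensional F E] [IsGalois F E] (x : E) {j : ℕ} (hj : 0 < j) :
    (Module.finrank F E / (minpoly F x).natDegree) •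
        logDerivCoeff ((minpoly F x).reverse : PowerSeries F) j
      = Algebra.trace F E (x ^ j) := by
  have hm := minpoly.monic (Algebra.IsIntegral.isIntegral (R := F) x)
  apply (algebraMap F E).injective
  have h1 : ((minpoly F x).reverse).map (algebraMap F E)
      = (((minpoly F x).aroots E).map fun y => 1 - C y * X).prod := by
    rw [← reverse_multiset_prod_X_sub_C, aroots,
      ← (IsGalois.splits F x).eq_prod_roots_of_monic (hm.map _), reverse, reverse,
      natDegree_map, reflect_map]
  rw [map_nsmul, ← logDerivCoeff_map _ _ (by rw [constantCoeff_coe_reverse hm]; exact one_ne_zero),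
    ← Polynomial.polynomial_map_coe, h1, coe_multiset_prod_one_sub,
    (logDerivCoeff_multiset_prod _ hj).2, trace_eq_sum_automorphisms,
    ← sum_algEquiv_eq_sum_aroots_minpoly (fun y => y ^ j) x]
  simp

open Polynomial in
theorem nsmul_logDerivCoeff_minpoly {F E : Type*} [Field F] [Field E] [Algebra F E]
    [FiniteDimensional F E] [IsGalois F E] {x : E} (hx : x ≠ 0) {j : ℕ} (hj : 0 < j) :
    (Module.finrank F E / (minpoly F x).natDegree) •
        logDerivCoeff (minpoly F x : PowerSeries F) j
      = Algebra.trace F E (x ^ j)⁻¹ := by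
  have hi := Algebra.IsIntegral.isIntegral (R := F) x
  have hm := minpoly.monic hi
  have h0 : (minpoly F x).coeff 0 ≠ 0 := minpoly.coeff_zero_ne_zero hi hx
  apply (algebraMap F E).injective
  set s := (minpoly F x).aroots E with hs
  have hy : ∀ y ∈ s, y ≠ 0 := by
    rintro y hy rfl
    rw [hs, mem_aroots, ← coeff_zero_eq_aeval_zero', map_eq_zero] at hy
    exact h0 hy.2
  have h1 : (minpoly F x).map (algebraMap F E)
      = C (s.map (- ·)).prod * ((s.map (·⁻¹)).map fun y => 1 - C y * X).prod := by
    conv_lhs => rw [(IsGalois.splits F x).eq_prod_roots_of_monic (hm.map _)]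
    rw [map_multiset_prod, Multiset.map_map, Multiset.map_map, ← Multiset.prod_map_mul]
    congr 1
    refine Multiset.map_congr rfl fun a ha => ?_
    have h := hy a ha
    simp only [Function.comp_apply]
    rw [mul_sub, ← mul_assoc, ← C_mul, neg_mul, mul_inv_cancel₀ h]
    simp
    ring
  rw [map_nsmul, ← logDerivCoeff_map _ _ (by rwa [constantCoeff_coe']),
    ← Polynomial.polynomial_map_coe, h1, coe_mul, coe_C, coe_multiset_prod_one_sub,
    logDerivCoeff_C_mul, (logDerivCoeff_multiset_prod _ hj).2, trace_eq_sum_automorphisms,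
    Multiset.map_map, Function.comp_def,
    ← sum_algEquiv_eq_sum_aroots_minpoly (fun y => y⁻¹ ^ j) x]
  · simp
  · rw [Ne, Multiset.prod_eq_zero_iff]
    simpa using fun h => hy 0 h rfl
  · rw [(logDerivCoeff_multiset_prod _ hj).1]
    exact one_ne_zero

open Polynomial in
theorem exists_powerSums_of_multiplicative {F : Type*} [Field F] [Fintype F] {D : ℕ} {lam : F[X] → ℂ}
    (hmul : ∀ g h : F[X], g.Monic → h.Monic → lam (g * h) = lam g * lam h) (h1 : lam 1 = 1)
    (hD : ∀ d, D < d → ∑ h ∈ monicsOfDegree F d, lam h = 0) :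
    ∃ s : Multiset ℂ, s.card ≤ D ∧ ∀ (E : Type) [Field E] [Fintype E] [Algebra F E],
      ∑ x : E, lam (minpoly F x) ^ (Module.finrank F E / (minpoly F x).natDegree)
        = -(s.map (· ^ Module.finrank F E)).sum := by
  have h0 : ∑ h ∈ monicsOfDegree F 0, lam h = 1 := by
    have : monicsOfDegree F 0 = {1} := by
      ext h
      rw [mem_monicsOfDegree, Finset.mem_singleton]
      constructor
      · rintro ⟨hm, hd⟩
        exact eq_one_of_monic_natDegree_zero hm hd
      · rintro rfl
        exact ⟨monic_one, natDegree_one⟩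
    rw [this, Finset.sum_singleton, h1]
  obtain ⟨s, hs, hs'⟩ := exists_powerSums_of_recurrence h0 hD
    (natDegree_mul_sum_monicsOfDegree hmul h1)
  refine ⟨s, hs, fun E _ _ _ => ?_⟩
  rw [← hs' _ Module.finrank_pos,
    sum_irreducibleFactors_eq_sum_minpoly fun P => lam P ^ (Module.finrank F E / P.natDegree)]

theorem AddChar.exists_mul_ne_one {F : Type*} [Field F] {ψ : AddChar F ℂ} (hψ : ψ ≠ 1) {c : F}
    (hc : c ≠ 0) : ∃ t, ψ (c * t) ≠ 1 := by
  obtain ⟨u, hu⟩ := AddChar.ne_one_iff.mp hψ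
  exact ⟨c⁻¹ * u, by rwa [mul_inv_cancel_left₀ hc]⟩

open Polynomial in
theorem exists_powerSums_pow {F : Type*} [Field F] [Fintype F] {ψ : AddChar F ℂ} (hψ : ψ ≠ 1)
    {k : ℕ} (hk : 2 ≤ k) (hkF : (k : F) ≠ 0) {a b : F} (ha : a ≠ 0) :
    ∃ s : Multiset ℂ, s.card ≤ k - 1 ∧ ∀ (E : Type) [Field E] [Fintype E] [Algebra F E],
      ∑ x : E, ψ (Algebra.trace F E (a • x ^ k + b • x)) = -(s.map (· ^ Module.finrank F E)).sum := by
  let lam : F[X] → ℂ := fun h =>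
    ψ (a * logDerivCoeff (h.reverse : PowerSeries F) k + b * logDerivCoeff (h.reverse : PowerSeries F) 1)
  have hmul : ∀ g h : F[X], g.Monic → h.Monic → lam (g * h) = lam g * lam h := by
    intro g h hg hh
    have hg' := (constantCoeff_coe_reverse hg).trans_ne one_ne_zero
    have hh' := (constantCoeff_coe_reverse hh).trans_ne one_ne_zero
    simp only [lam, reverse_mul_of_domain, coe_mul, logDerivCoeff_mul hg' hh']
    rw [← AddChar.map_add_eq_mul]
    congr 1
    ring
  have h1 : lam 1 = 1 := by
    simp only [lam, ← C_1, reverse_C]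
    simp [logDerivCoeff_one]
  have hD : ∀ d, k - 1 < d → ∑ h ∈ monicsOfDegree F d, lam h = 0 := by
    intro d hd
    obtain ⟨t, ht⟩ := AddChar.exists_mul_ne_one hψ (c := -(a * k)) (by simp [ha, hkF])
    have hlt : ∀ t : F, (C t * X ^ (d - k)).degree < (d : WithBot ℕ) := fun t =>
      (degree_C_mul_X_pow_le _ _).trans_lt (by exact_mod_cast (by omega : d - k < d))
    have hmem : ∀ t : F, ∀ h ∈ monicsOfDegree F d, h + C t * X ^ (d - k) ∈ monicsOfDegree F d := by
      intro t h hh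
      rw [mem_monicsOfDegree] at hh ⊢
      have h2 : (C t * X ^ (d - k)).degree < h.degree := by
        rw [degree_eq_natDegree hh.1.ne_zero, hh.2]
        exact hlt t
      exact ⟨hh.1.add_of_left h2, by rw [natDegree_add_eq_left_of_degree_lt h2, hh.2]⟩
    have hshift : ∀ h ∈ monicsOfDegree F d, lam (h + C t * X ^ (d - k)) = ψ (-(a * k) * t) * lam h := by
      intro h hh
      have hdeg := (mem_monicsOfDegree.mp (hmem t h hh)).2
      rw [mem_monicsOfDegree] at hh
      have hr : (h + C t * X ^ (d - k)).reverse = h.reverse + C t * X ^ k := by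
        rw [reverse, hdeg, reflect_add, reflect_C_mul_X_pow, revAt_le (by omega), reverse, hh.2]
        congr 3
        omega
      have h2 := constantCoeff_coe_reverse hh.1
      simp only [lam, hr]
      rw [coe_add, coe_mul, coe_C, coe_pow, coe_X,
        logDerivCoeff_add (h2.trans_ne one_ne_zero) t (by omega) le_rfl,
        logDerivCoeff_add (h2.trans_ne one_ne_zero) t (by omega) (by omega : 1 ≤ k), if_pos rfl,
        if_neg (by omega), h2, ← AddChar.map_add_eq_mul]
      congr 1
      ring
    have hsum : ∑ h ∈ monicsOfDegree F d, lam h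
        = ∑ h ∈ monicsOfDegree F d, lam (h + C t * X ^ (d - k)) := by
      symm
      refine Finset.sum_nbij' (fun h => h + C t * X ^ (d - k)) (fun h => h + C (-t) * X ^ (d - k))
        (hmem t) (hmem (-t)) ?_ ?_ (fun _ _ => rfl)
      · intro h _; simp
      · intro h _; simp
    rw [Finset.sum_congr rfl hshift, ← Finset.mul_sum] at hsum
    by_contra hne
    exact ht (mul_right_cancel₀ hne (hsum.symm.trans (one_mul _).symm))
  obtain ⟨s, hs, hs'⟩ := exists_powerSums_of_multiplicative hmul h1 hD
  refine ⟨s, hs, fun E _ _ _ => ?_⟩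
  rw [← hs' E]
  refine Finset.sum_congr rfl fun x _ => ?_
  simp only [lam]
  rw [← AddChar.map_nsmul_eq_pow, map_add, map_smul, map_smul,
    ← nsmul_logDerivCoeff_reverse_minpoly x (by omega : 0 < k)]
  conv_lhs => rw [← pow_one x, ← nsmul_logDerivCoeff_reverse_minpoly x one_pos, pow_one]
  congr 1
  simp only [smul_eq_mul, nsmul_eq_mul]
  ring

open Polynomial Classical in
theorem exists_powerSums_inv_pow {F : Type*} [Field F] [Fintype F] {ψ : AddChar F ℂ} (hψ : ψ ≠ 1)
    {m : ℕ} (hm : 0 < m) (hmF : (m : F) ≠ 0) {a b : F} (ha : a ≠ 0) :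
    ∃ s : Multiset ℂ, s.card ≤ m + 1 ∧ ∀ (E : Type) [Field E] [Fintype E] [Algebra F E],
      ∑ x ∈ Finset.univ.filter (fun x : E => x ≠ 0),
        ψ (Algebra.trace F E (a • (x ^ m)⁻¹ + b • x)) = -(s.map (· ^ Module.finrank F E)).sum := by
  let lam : F[X] → ℂ := fun h => if h.coeff 0 = 0 then 0 else
    ψ (a * logDerivCoeff (h : PowerSeries F) m + b * logDerivCoeff (h.reverse : PowerSeries F) 1)
  have hmul : ∀ g h : F[X], g.Monic → h.Monic → lam (g * h) = lam g * lam h := by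
    intro g h hg hh
    have hg' := (constantCoeff_coe_reverse hg).trans_ne one_ne_zero
    have hh' := (constantCoeff_coe_reverse hh).trans_ne one_ne_zero
    simp only [lam, mul_coeff_zero]
    by_cases hg0 : g.coeff 0 = 0
    · simp [hg0]
    by_cases hh0 : h.coeff 0 = 0
    · simp [hh0]
    rw [if_neg (mul_ne_zero hg0 hh0), if_neg hg0, if_neg hh0]
    rw [← constantCoeff_coe'] at hg0 hh0
    simp only [reverse_mul_of_domain, coe_mul, logDerivCoeff_mul hg' hh', logDerivCoeff_mul hg0 hh0]
    rw [← AddChar.map_add_eq_mul]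
    congr 1
    ring
  have h1 : lam 1 = 1 := by
    simp only [lam, ← C_1, reverse_C]
    simp [logDerivCoeff_one]
  have hD : ∀ d, m + 1 < d → ∑ h ∈ monicsOfDegree F d, lam h = 0 := by
    intro d hd
    obtain ⟨t, ht⟩ := AddChar.exists_mul_ne_one hψ (c := -(a * m)) (by simp [ha, hmF])
    have hlt : ∀ t : F, (C t * X ^ m).degree < (d : WithBot ℕ) := fun t =>
      (degree_C_mul_X_pow_le _ _).trans_lt (by exact_mod_cast (by omega : m < d))
    have hmem : ∀ t : F, ∀ h ∈ monicsOfDegree F d,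
        h + C (t * h.coeff 0) * X ^ m ∈ monicsOfDegree F d := by
      intro t h hh
      rw [mem_monicsOfDegree] at hh ⊢
      have h2 : (C (t * h.coeff 0) * X ^ m).degree < h.degree := by
        rw [degree_eq_natDegree hh.1.ne_zero, hh.2]
        exact hlt _
      exact ⟨hh.1.add_of_left h2, by rw [natDegree_add_eq_left_of_degree_lt h2, hh.2]⟩
    have hc0 : ∀ (t : F) (h : F[X]), (h + C (t * h.coeff 0) * X ^ m).coeff 0 = h.coeff 0 := by
      intro t h
      simp [hm.ne]
    have hshift : ∀ h ∈ monicsOfDegree F d,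
        lam (h + C (t * h.coeff 0) * X ^ m) = ψ (-(a * m) * t) * lam h := by
      intro h hh
      have hdeg := (mem_monicsOfDegree.mp (hmem t h hh)).2
      rw [mem_monicsOfDegree] at hh
      simp only [lam, hc0]
      split_ifs with h0
      · simp
      have hr : (h + C (t * h.coeff 0) * X ^ m).reverse
          = h.reverse + C (t * h.coeff 0) * X ^ (d - m) := by
        rw [reverse, hdeg, reflect_add, reflect_C_mul_X_pow, revAt_le (by omega), reverse, hh.2]
      have h2 := constantCoeff_coe_reverse hh.1
      have h3 : PowerSeries.constantCoeff (h : PowerSeries F) ≠ 0 := by rwa [constantCoeff_coe']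
      rw [hr, coe_add, coe_mul, coe_C, coe_pow, coe_X, coe_add, coe_mul, coe_C, coe_pow, coe_X,
        logDerivCoeff_add h3 _ hm le_rfl,
        logDerivCoeff_add (h2.trans_ne one_ne_zero) _ (by omega) (by omega : 1 ≤ d - m), if_pos rfl,
        if_neg (by omega), constantCoeff_coe', ← AddChar.map_add_eq_mul]
      congr 1
      field_simp
      ring
    have hsum : ∑ h ∈ monicsOfDegree F d, lam h
        = ∑ h ∈ monicsOfDegree F d, lam (h + C (t * h.coeff 0) * X ^ m) := by
      symm
      refine Finset.sum_nbij' (fun h => h + C (t * h.coeff 0) * X ^ m)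
        (fun h => h + C (-t * h.coeff 0) * X ^ m) (hmem t) (hmem (-t)) ?_ ?_ (fun _ _ => rfl)
      · intro h _
        simp only [hc0]
        simp
      · intro h _
        simp only [hc0]
        simp
    rw [Finset.sum_congr rfl hshift, ← Finset.mul_sum] at hsum
    by_contra hne
    exact ht (mul_right_cancel₀ hne (hsum.symm.trans (one_mul _).symm))
  obtain ⟨s, hs, hs'⟩ := exists_powerSums_of_multiplicative hmul h1 hD
  refine ⟨s, hs, fun E _ _ _ => ?_⟩
  rw [← hs' E, Finset.sum_filter]
  refine Finset.sum_congr rfl fun x _ => ?_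
  have hx := Algebra.IsIntegral.isIntegral (R := F) x
  simp only [lam, minpoly.coeff_zero_eq_zero hx]
  have hpos : 0 < Module.finrank F E / (minpoly F x).natDegree :=
    Nat.div_pos (Nat.le_of_dvd Module.finrank_pos (minpoly.degree_dvd hx)) (minpoly.natDegree_pos hx)
  by_cases hx0 : x = 0
  · rw [if_neg (by simpa using hx0), if_pos hx0, zero_pow hpos.ne']
  rw [if_pos hx0, if_neg hx0]
  rw [← AddChar.map_nsmul_eq_pow, map_add, map_smul, map_smul,
    ← nsmul_logDerivCoeff_minpoly hx0 hm]
  conv_lhs => rw [← pow_one x, ← nsmul_logDerivCoeff_reverse_minpoly x one_pos, pow_one]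
  congr 1
  simp only [smul_eq_mul, nsmul_eq_mul]
  ring

open Polynomial in
theorem norm_le_of_powerSums_le {s : Multiset ℂ} {B q : ℝ} (hq : 0 < q)
    (h : ∀ n : ℕ, ‖(s.map (· ^ (n + 1))).sum‖ ≤ B * q ^ (n + 1)) {w : ℂ} (hw : w ∈ s) :
    ‖w‖ ≤ q := by
  classical
  set P : ℂ[X] := ∏ v ∈ s.toFinset.erase w, (X - C v) with hP
  have hPw : P.eval w ≠ 0 := by
    rw [hP, eval_prod, Finset.prod_ne_zero_iff]
    intro v hv
    rw [eval_sub, eval_X, eval_C, sub_ne_zero]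
    exact (Finset.ne_of_mem_erase hv).symm
  have hPv : ∀ v ∈ s, v ≠ w → P.eval v = 0 := by
    intro v hv hvw
    rw [hP, eval_prod]
    exact Finset.prod_eq_zero (Finset.mem_erase.mpr ⟨hvw, Multiset.mem_toFinset.mpr hv⟩) (by simp)
  have h1 : ∀ n : ℕ, (s.map fun v => v ^ (n + 1) * P.eval v).sum
      = s.count w * (w ^ (n + 1) * P.eval w) := by
    intro n
    rw [Finset.sum_multiset_map_count, Finset.sum_eq_single_of_mem w (Multiset.mem_toFinset.mpr hw),
      nsmul_eq_mul]
    intro v hv hvw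
    rw [hPv v (Multiset.mem_toFinset.mp hv) hvw, mul_zero, smul_zero]
  have h2 : ∀ n : ℕ, (s.map fun v => v ^ (n + 1) * P.eval v).sum
      = ∑ t ∈ Finset.range (P.natDegree + 1), P.coeff t * (s.map (· ^ (n + t + 1))).sum := by
    intro n
    simp only [Finset.sum_multiset_map_count, Finset.mul_sum]
    rw [Finset.sum_comm]
    refine Finset.sum_congr rfl fun v _ => ?_
    rw [eval_eq_sum_range, Finset.mul_sum, Finset.smul_sum]
    refine Finset.sum_congr rfl fun t _ => ?_
    simp only [nsmul_eq_mul]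
    ring
  set K : ℝ := ∑ t ∈ Finset.range (P.natDegree + 1), ‖P.coeff t‖ * (B * q ^ t) with hK
  have h3 : ∀ n : ℕ, ‖w‖ ^ (n + 1) * (s.count w * ‖P.eval w‖) ≤ K * q ^ (n + 1) := by
    intro n
    have h4 : ‖w‖ ^ (n + 1) * (s.count w * ‖P.eval w‖) = ‖(s.map fun v => v ^ (n + 1) * P.eval v).sum‖ := by
      rw [h1]
      simp
      ring
    rw [h4, h2, hK, Finset.sum_mul]
    refine norm_sum_le_of_le _ fun t _ => ?_
    rw [norm_mul, mul_assoc, mul_assoc, ← pow_add]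
    refine mul_le_mul_of_nonneg_left ?_ (norm_nonneg _)
    rw [show t + (n + 1) = n + t + 1 by ring]
    exact h _
  set M : ℝ := s.count w * ‖P.eval w‖ with hM
  have hM0 : 0 < M := mul_pos (by exact_mod_cast Multiset.count_pos.mpr hw) (norm_pos_iff.mpr hPw)
  by_contra! hlt
  obtain ⟨n, hn⟩ := pow_unbounded_of_one_lt (K / M) ((one_lt_div hq).mpr hlt)
  have h5 : (‖w‖ / q) ^ (n + 1) ≤ K / M := by
    rw [div_pow, div_le_div_iff₀ (by positivity) hM0]
    exact h3 n
  have h6 : (‖w‖ / q) ^ n ≤ (‖w‖ / q) ^ (n + 1) :=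
    pow_le_pow_right₀ ((one_lt_div hq).mpr hlt).le (Nat.le_succ n)
  linarith

theorem norm_le_sqrt_of_even_powerSums_le {s : Multiset ℂ} {B q : ℝ} (hq : 0 < q)
    (h : ∀ n : ℕ, ‖(s.map (· ^ (2 * (n + 1)))).sum‖ ≤ B * q ^ (n + 1)) :
    ‖s.sum‖ ≤ s.card * √q := by
  have h1 : ∀ w ∈ s, ‖w‖ ≤ √q := by
    intro w hw
    refine Real.le_sqrt_of_sq_le ?_
    rw [← norm_pow]
    refine norm_le_of_powerSums_le (s := s.map (· ^ 2)) (B := B) hq (fun n => ?_)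
      (Multiset.mem_map_of_mem _ hw)
    rw [Multiset.map_map]
    simpa only [Function.comp_def, ← pow_mul] using h n
  refine (norm_multiset_sum_le _).trans ?_
  rw [← nsmul_eq_mul, ← Multiset.card_map (‖·‖) s]
  refine Multiset.sum_le_card_nsmul _ _ fun x hx => ?_
  obtain ⟨w, hw, rfl⟩ := Multiset.mem_map.mp hx
  exact h1 w hw

theorem ZMod.exists_extension_finrank_eq (p : ℕ) [Fact p.Prime] {n : ℕ} (hn : n ≠ 0) :
    ∃ (E : Type) (_ : Field E) (_ : Fintype E) (_ : Algebra (ZMod p) E),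
      Module.finrank (ZMod p) E = n :=
  ⟨GaloisField p n, inferInstance, Fintype.ofFinite _, inferInstance, GaloisField.finrank p hn⟩

open Polynomial in
theorem norm_sum_addChar_pow_le {p k : ℕ} [Fact p.Prime] {ψ : AddChar (ZMod p) ℂ} (hψ : ψ ≠ 1)
    (hk : 2 ≤ k) (hkp : ¬ p ∣ k) {a : ZMod p} (ha : a ≠ 0) (b : ZMod p) :
    ‖∑ x : ZMod p, ψ (a * x ^ k + b * x)‖ ≤ (k - 1 : ℕ) * √p := by
  classical
  have hp : 0 < (p : ℝ) := by exact_mod_cast (Fact.out : p.Prime).pos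
  obtain ⟨s, hs, hsE⟩ := exists_powerSums_pow hψ hk
    (by rwa [Ne, CharP.cast_eq_zero_iff (ZMod p) p]) ha (b := b)
  have h0 : ∑ x : ZMod p, ψ (a * x ^ k + b * x) = -s.sum := by
    simpa using hsE (ZMod p)
  rw [h0, norm_neg]
  refine (norm_le_sqrt_of_even_powerSums_le hp
    (B := (p * (p * (2 * k + 1)) : ℕ) + 1) fun n => ?_).trans
    (mul_le_mul_of_nonneg_right (by exact_mod_cast hs) (Real.sqrt_nonneg _))
  obtain ⟨E, _, _, _, hE⟩ := ZMod.exists_extension_finrank_eq p (show 2 * (n + 1) ≠ 0 by omega)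
  have h1 := hsE E
  rw [hE] at h1
  rw [← norm_neg, ← h1, ← Finset.add_sum_erase _ _ (Finset.mem_univ (0 : E))]
  set P : E[X] := C (algebraMap _ E a) * X ^ k + C (algebraMap _ E b) * X with hP
  have hPd : P.natDegree = 0 + k := by
    rw [hP]
    have : algebraMap (ZMod p) E a ≠ 0 := by simpa using ha
    rw [natDegree_add_eq_left_of_natDegree_lt, natDegree_C_mul_X_pow _ _ this, zero_add]
    rw [natDegree_C_mul_X_pow _ _ this]
    exact (natDegree_C_mul_le _ _).trans_lt (by rw [natDegree_X]; omega)
  have h2 := norm_sum_addChar_trace_le hE (by omega) hkp hPd hψ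
  rw [zero_add] at h2
  have h3 : ∑ x ∈ Finset.univ.erase (0 : E), ψ (Algebra.trace (ZMod p) E (a • x ^ k + b • x))
      = ∑ x ∈ Finset.univ.filter (fun x : E => x ≠ 0),
        ψ (Algebra.trace (ZMod p) E (P.eval x / x ^ 0)) := by
    refine Finset.sum_congr (by ext; simp) fun x _ => ?_
    simp [hP, Algebra.smul_def]
  rw [h3]
  refine (norm_add_le _ _).trans ?_
  rw [ψ.norm_apply, add_mul, add_comm, one_mul]
  refine add_le_add h2 (one_le_pow₀ ?_)
  exact_mod_cast (Fact.out : p.Prime).one_lt.le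

open Polynomial in
theorem norm_sum_addChar_inv_pow_le {p m : ℕ} [Fact p.Prime] {ψ : AddChar (ZMod p) ℂ} (hψ : ψ ≠ 1)
    (hm : 0 < m) (hmp : ¬ p ∣ m) {a : ZMod p} (ha : a ≠ 0) (b : ZMod p) :
    ‖∑ x ∈ Finset.univ.filter (fun x : ZMod p => x ≠ 0), ψ (a * (x ^ m)⁻¹ + b * x)‖
      ≤ (m + 1 : ℕ) * √p := by
  classical
  have hp : 0 < (p : ℝ) := by exact_mod_cast (Fact.out : p.Prime).pos
  have hp1 : (1 : ℝ) ≤ p := by exact_mod_cast (Fact.out : p.Prime).one_lt.le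
  rcases eq_or_ne b 0 with rfl | hb
  · have hsq : 1 ≤ √(p : ℝ) := Real.one_le_sqrt.mpr hp1
    have h0 : ∑ x ∈ Finset.univ.filter (fun x : ZMod p => x ≠ 0), ψ (a * (x ^ m)⁻¹ + 0 * x)
        = (∑ x : ZMod p, ψ (a * x ^ m + 0 * x)) - 1 := by
      rw [eq_sub_iff_add_eq', ← Finset.add_sum_erase _ _ (Finset.mem_univ (0 : ZMod p))]
      congr 1
      · simp [hm.ne']
      · refine Finset.sum_bij' (fun x _ => x⁻¹) (fun x _ => x⁻¹) ?_ ?_ ?_ ?_ ?_ <;> simp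
    rw [h0]
    have h1 : ‖∑ x : ZMod p, ψ (a * x ^ m + 0 * x)‖ ≤ (m - 1 : ℕ) * √p := by
      rcases (show m = 1 ∨ 2 ≤ m by omega) with rfl | hm2
      · have : ∑ x : ZMod p, ψ (a * x ^ 1 + 0 * x) = 0 := by
          simp only [pow_one, zero_mul, add_zero]
          rw [← AddChar.sum_eq_zero_of_ne_one hψ]
          exact Fintype.sum_bijective _ (Equiv.mulLeft₀ a ha).bijective _ _ fun _ => rfl
        rw [this]
        simp
      · exact norm_sum_addChar_pow_le hψ hm2 hmp ha 0
    refine (norm_sub_le _ _).trans ?_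
    rw [norm_one]
    have h2 : ((m - 1 : ℕ) : ℝ) = m - 1 := by push_cast [Nat.cast_sub hm]; ring
    rw [h2] at h1
    push_cast
    nlinarith
  obtain ⟨s, hs, hsE⟩ := exists_powerSums_inv_pow hψ hm
    (by rwa [Ne, CharP.cast_eq_zero_iff (ZMod p) p]) ha (b := b)
  have h0 : ∑ x ∈ Finset.univ.filter (fun x : ZMod p => x ≠ 0), ψ (a * (x ^ m)⁻¹ + b * x) = -s.sum := by
    convert hsE (ZMod p) using 2 <;> simp
  rw [h0, norm_neg]
  refine (norm_le_sqrt_of_even_powerSums_le hp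
    (B := (p * (p * (2 * (m + 1) + 1)) : ℕ)) fun n => ?_).trans
    (mul_le_mul_of_nonneg_right (by exact_mod_cast hs) (Real.sqrt_nonneg _))
  obtain ⟨E, _, _, _, hE⟩ := ZMod.exists_extension_finrank_eq p (show 2 * (n + 1) ≠ 0 by omega)
  have h1 := hsE E
  rw [hE] at h1
  rw [← norm_neg, ← h1]
  set P : E[X] := C (algebraMap _ E b) * X ^ (m + 1) + C (algebraMap _ E a) with hP
  have hPd : P.natDegree = m + 1 := by
    rw [hP, natDegree_add_C, natDegree_C_mul_X_pow _ _ (by simpa using hb)]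
  have h2 := norm_sum_addChar_trace_le hE one_pos (Fact.out : p.Prime).not_dvd_one hPd hψ
  refine le_of_eq_of_le ?_ h2
  congr 1
  refine Finset.sum_congr (by ext; simp) fun x hx => ?_
  have hx' : x ≠ 0 := by simpa using hx
  congr 2
  simp only [hP, Algebra.smul_def, eval_add, eval_mul, eval_C, eval_pow, eval_X]
  field_simp
  ring

/-- The Weil bound for the exponential sum attached to `a x ^ k + b x` with an integer exponent `k`. -/
theorem norm_sum_addChar_zpow_le {p : ℕ} [Fact p.Prime] {ψ : AddChar (ZMod p) ℂ} (hψ : ψ ≠ 1)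
    {k : ℤ} (hk1 : k ≠ 1) (hkp : ¬ (p : ℤ) ∣ k) {a : ZMod p} (ha : a ≠ 0) (b : ZMod p) :
    ‖∑ x ∈ Finset.univ.filter (fun x : ZMod p => x ≠ 0), ψ (a * x ^ k + b * x)‖
      ≤ (|k - 1| : ℤ) * √p + 1 := by
  have hk0 : k ≠ 0 := by
    rintro rfl
    exact hkp (dvd_zero _)
  rcases lt_or_gt_of_ne hk0 with hk | hk
  · obtain ⟨m, rfl⟩ : ∃ m : ℕ, k = -m := ⟨k.natAbs, by omega⟩
    have h := norm_sum_addChar_inv_pow_le hψ (m := m) (by omega)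
      (fun h => hkp ((Int.natCast_dvd_natCast.mpr h).neg_right)) ha b
    have hm : |(-m : ℤ) - 1| = m + 1 := by rw [abs_of_neg (by omega)]; ring
    rw [hm]
    simp only [zpow_neg, zpow_natCast]
    push_cast at h ⊢
    linarith
  · obtain ⟨m, rfl⟩ : ∃ m : ℕ, k = m := ⟨k.toNat, by omega⟩
    have h := norm_sum_addChar_pow_le hψ (k := m) (by omega)
      (fun h => hkp (Int.natCast_dvd_natCast.mpr h)) ha b
    have hm : |(m : ℤ) - 1| = (m - 1 : ℕ) := by rw [abs_of_nonneg (by omega)]; omega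
    rw [hm, Int.cast_natCast]
    simp only [zpow_natCast]
    rw [← Finset.add_sum_erase _ _ (Finset.mem_univ (0 : ZMod p))] at h
    have h0 : ψ (a * 0 ^ m + b * 0) = 1 := by simp [show m ≠ 0 by omega]
    rw [h0, show Finset.univ.erase (0 : ZMod p) = Finset.univ.filter (fun x : ZMod p => x ≠ 0) by
      ext; simp] at h
    set S := ∑ x ∈ Finset.univ.filter (fun x : ZMod p => x ≠ 0), ψ (a * x ^ m + b * x)
    calc ‖S‖ = ‖(1 + S) - 1‖ := by rw [add_sub_cancel_left]
      _ ≤ ‖1 + S‖ + ‖(1 : ℂ)‖ := norm_sub_le _ _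
      _ ≤ _ := by rw [norm_one]; linarith

/-- The Parseval identity for the indicator function of a finite subset of a finite field. -/
theorem sum_norm_sum_addChar_mul_sq {F : Type*} [Field F] [Fintype F] {ψ : AddChar F ℂ}
    (hψ : ψ.IsPrimitive) (T : Finset F) :
    ∑ b : F, ‖∑ t ∈ T, ψ (-(b * t))‖ ^ 2 = Fintype.card F * T.card := by
  classical
  have h : ((∑ b : F, ‖∑ t ∈ T, ψ (-(b * t))‖ ^ 2 : ℝ) : ℂ) = Fintype.card F * T.card := by
    push_cast
    simp only [← Complex.conj_mul', map_sum, Finset.sum_mul_sum, ← AddChar.map_neg_eq_conj,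
      ← AddChar.map_add_eq_mul]
    rw [Finset.sum_comm]
    have : ∀ t ∈ T, ∑ b : F, ∑ u ∈ T, ψ (- -(b * t) + -(b * u)) = Fintype.card F := by
      intro t ht
      rw [Finset.sum_comm, Finset.sum_eq_single_of_mem t ht]
      · simp
      · intro u _ hut
        have := AddChar.sum_mulShift (t - u) hψ
        rw [if_neg (sub_ne_zero.mpr hut.symm), Nat.cast_zero] at this
        rw [← this]
        refine Finset.sum_congr rfl fun b _ => ?_
        congr 1
        ring
    rw [Finset.sum_congr rfl this, Finset.sum_const, nsmul_eq_mul, mul_comm]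
  exact_mod_cast h

/-- A bound for incomplete sums by completion, from a uniform bound for the twisted complete sums. -/
theorem norm_sum_sum_addChar_le {F : Type*} [Field F] [Fintype F] {ψ : AddChar F ℂ}
    (hψ : ψ.IsPrimitive) {g : F → F} {X : Finset F} {W : ℝ}
    (hW : ∀ b, ‖∑ x ∈ X, ψ (g x + b * x)‖ ≤ W) {T : Finset F} {y : F}
    (hT : ∀ t ∈ T, ∀ u ∈ T, y + t + u ∈ X) :
    ‖∑ t ∈ T, ∑ u ∈ T, ψ (g (y + t + u))‖ ≤ W * T.card := by
  classical
  have hcard : (0 : ℝ) < Fintype.card F := by exact_mod_cast Fintype.card_pos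
  have hinv : ∀ z ∈ X, ∑ b : F, (∑ x ∈ X, ψ (g x + b * x)) * ψ (-(b * z))
      = Fintype.card F * ψ (g z) := by
    intro z hz
    simp only [Finset.sum_mul, ← AddChar.map_add_eq_mul]
    rw [Finset.sum_comm, Finset.sum_eq_single_of_mem z hz]
    · simp
    · intro x _ hxz
      have := AddChar.sum_mulShift (x - z) hψ
      rw [if_neg (sub_ne_zero.mpr hxz)] at this
      rw [← mul_zero (ψ (g x)), ← Nat.cast_zero, ← this, Finset.mul_sum]
      refine Finset.sum_congr rfl fun b _ => ?_
      rw [← AddChar.map_add_eq_mul]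
      congr 1
      ring
  have hS : Fintype.card F * ∑ t ∈ T, ∑ u ∈ T, ψ (g (y + t + u))
      = ∑ b : F, (∑ x ∈ X, ψ (g x + b * x)) * ψ (-(b * y)) * (∑ t ∈ T, ψ (-(b * t))) ^ 2 := by
    rw [Finset.mul_sum]
    simp only [Finset.mul_sum]
    rw [Finset.sum_congr rfl fun t ht => Finset.sum_congr rfl fun u hu => (hinv _ (hT t ht u hu)).symm]
    simp only [sq, Finset.sum_mul_sum]
    rw [Finset.sum_congr rfl fun t _ => Finset.sum_comm, Finset.sum_comm]
    refine Finset.sum_congr rfl fun b _ => ?_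
    rw [Finset.mul_sum]
    refine Finset.sum_congr rfl fun t _ => ?_
    rw [Finset.mul_sum]
    refine Finset.sum_congr rfl fun u _ => ?_
    rw [mul_assoc, ← AddChar.map_add_eq_mul, ← AddChar.map_add_eq_mul]
    congr 2
    ring
  have hnorm := congrArg norm hS
  rw [norm_mul, Complex.norm_natCast] at hnorm
  refine le_of_mul_le_mul_left ?_ hcard
  rw [hnorm, mul_left_comm, ← sum_norm_sum_addChar_mul_sq hψ T, Finset.mul_sum]
  refine norm_sum_le_of_le _ fun b _ => ?_
  rw [norm_mul, norm_mul, ψ.norm_apply, mul_one, norm_pow]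
  exact mul_le_mul_of_nonneg_right (hW b) (by positivity)

theorem half_le_re_exp_mul_stdAddChar {p n s : ℕ} [NeZero p] (hn : 3 ≤ n) (hs : n * s < p) :
    1 / 2 ≤ (Complex.exp (-(Real.pi * ((p - 1) / n : ℕ) / p * Complex.I))
      * ZMod.stdAddChar ((s : ℤ) : ZMod p)).re := by
  have hp : 0 < p := NeZero.pos p
  have hp' : (0 : ℝ) < p := by exact_mod_cast hp
  set S := (p - 1) / n with hS
  have hsS : s ≤ S := (Nat.le_div_iff_mul_le (by omega)).mpr (by rw [mul_comm]; omega)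
  have hnS : 3 * S ≤ p := by
    have : n * S ≤ p - 1 := Nat.mul_div_le _ _
    nlinarith [Nat.sub_le p 1]
  rw [ZMod.stdAddChar_coe, ← Complex.exp_add]
  have harg : -(Real.pi * (S : ℂ) / p * Complex.I) + 2 * Real.pi * Complex.I * (s : ℤ) / p
      = ((Real.pi * (2 * s - S) / p : ℝ) : ℂ) * Complex.I := by
    push_cast
    ring
  rw [harg, Complex.exp_ofReal_mul_I_re, ← Real.cos_pi_div_three, ← Real.cos_abs (Real.pi * _ / _)]
  have hpi := Real.pi_pos
  refine Real.cos_le_cos_of_nonneg_of_le_pi (abs_nonneg _) (by linarith) ?_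
  rw [abs_div, abs_mul, abs_of_pos hpi, abs_of_pos hp', div_le_div_iff₀ hp' (by norm_num)]
  have h1 : |(2 * s - S : ℝ)| ≤ S := by
    have : (s : ℝ) ≤ S := by exact_mod_cast hsS
    rw [abs_le]
    constructor <;> linarith [(Nat.cast_nonneg s : (0 : ℝ) ≤ s)]
  have h2 : (3 : ℝ) * S ≤ p := by exact_mod_cast hnS
  rw [mul_assoc]
  exact mul_le_mul_of_nonneg_left (by linarith) hpi.le

/-- If `g` maps a residue class modulo `n ≥ 3` into another one, then some twisted exponential sum
of `g` is large. -/
theorem div_le_of_image_Iclass_subset {p n i j : ℕ} [Fact p.Prime] (hn : 3 ≤ n) (hnp : n < p)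
    (hi : i < n) {g : ZMod p → ZMod p} {W : ℝ}
    (hW : ∀ b, ‖∑ x ∈ Finset.univ.filter (fun x : ZMod p => x ≠ 0),
      ZMod.stdAddChar ((n : ZMod p)⁻¹ * g x + b * x)‖ ≤ W)
    (hg : ∀ x ∈ Iclass p n i, (g x).val % n = j) :
    (((p - 1) / (2 * n) : ℕ) : ℝ) ≤ 2 * W := by
  classical
  have hn0 : (n : ZMod p) ≠ 0 := by
    rw [Ne, CharP.cast_eq_zero_iff (ZMod p) p]
    exact Nat.not_dvd_of_pos_of_lt (by omega) hnp
  set M := (p - 1) / (2 * n) with hM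
  have hM' : 2 * n * M ≤ p - 1 := Nat.mul_div_le _ _
  obtain ⟨y, hy1, hyn, hyi⟩ : ∃ y, 1 ≤ y ∧ y ≤ n ∧ y % n = i := by
    rcases Nat.eq_zero_or_pos i with rfl | hi0
    · exact ⟨n, by omega, le_rfl, Nat.mod_self n⟩
    · exact ⟨i, hi0, hi.le, Nat.mod_eq_of_lt hi⟩
  have hmem : ∀ t < M, ∀ u < M, y + n * t + n * u ∈ Iclass p n i := by
    intro t ht u hu
    rw [Iclass, Finset.mem_filter, Finset.mem_Icc]
    have h1 : n * (t + u + 2) ≤ n * (2 * M) := Nat.mul_le_mul_left _ (by omega)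
    refine ⟨⟨by omega, ?_⟩, ?_⟩
    · nlinarith
    · rw [Nat.add_mul_mod_self_left, Nat.add_mul_mod_self_left, hyi]
  have hIcc : ∀ x ∈ Iclass p n i, (x : ZMod p) ≠ 0 := by
    intro x hx
    rw [Iclass, Finset.mem_filter, Finset.mem_Icc] at hx
    rw [Ne, CharP.cast_eq_zero_iff (ZMod p) p]
    exact Nat.not_dvd_of_pos_of_lt (by omega) (by omega)
  set T : Finset (ZMod p) := (Finset.range M).image fun t : ℕ => (n : ZMod p) * t with hT
  have hTcard : T.card = M := by
    rw [hT, Finset.card_image_of_injOn, Finset.card_range]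
    intro t ht u hu htu
    have hMp : M ≤ p - 1 := Nat.div_le_self _ _
    simp only [Finset.coe_range, Set.mem_Iio] at ht hu
    have h1 := mul_left_cancel₀ hn0 htu
    rw [ZMod.natCast_eq_natCast_iff'] at h1
    rwa [Nat.mod_eq_of_lt (by omega), Nat.mod_eq_of_lt (by omega)] at h1
  have hcast : ∀ t ∈ T, ∀ u ∈ T, ∃ x ∈ Iclass p n i, (y : ZMod p) + t + u = (x : ZMod p) := by
    intro t ht u hu
    simp only [hT, Finset.mem_image, Finset.mem_range] at ht hu
    obtain ⟨t, ht, rfl⟩ := ht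
    obtain ⟨u, hu, rfl⟩ := hu
    exact ⟨_, hmem t ht u hu, by push_cast; ring⟩
  have hupper := norm_sum_sum_addChar_le (ZMod.isPrimitive_stdAddChar p)
    (g := fun x => (n : ZMod p)⁻¹ * g x) hW (T := T) (y := y) (by
      intro t ht u hu
      obtain ⟨x, hx, h⟩ := hcast t ht u hu
      rw [h]
      simpa using hIcc x hx)
  set κ : ℂ := ZMod.stdAddChar (-((n : ZMod p)⁻¹ * (j : ZMod p)))
    * Complex.exp (-(Real.pi * ((p - 1) / n : ℕ) / p * Complex.I)) with hκ
  have hκ1 : ‖κ‖ = 1 := by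
    rw [hκ, norm_mul, AddChar.norm_apply, one_mul, Complex.norm_exp]
    simp [Complex.div_re]
  have hre : ∀ t ∈ T, ∀ u ∈ T,
      1 / 2 ≤ (κ * ZMod.stdAddChar ((n : ZMod p)⁻¹ * g (y + t + u))).re := by
    intro t ht u hu
    obtain ⟨x, hx, h⟩ := hcast t ht u hu
    rw [h]
    have hlt := ZMod.val_lt (g x)
    have hv := Nat.div_add_mod (g x).val n
    rw [hg x hx] at hv
    set s := (g x).val / n with hs
    have hgx : (n : ZMod p)⁻¹ * g x = ((s : ℤ) : ZMod p) + (n : ZMod p)⁻¹ * (j : ZMod p) := by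
      conv_lhs => rw [← ZMod.natCast_zmod_val (g x), ← hv]
      push_cast
      field_simp
    refine (half_le_re_exp_mul_stdAddChar (p := p) hn (s := s) (by omega)).trans_eq ?_
    congr 1
    rw [hκ, hgx, AddChar.map_add_eq_mul, AddChar.map_neg_eq_inv]
    have := norm_ne_zero_iff.mp
      ((AddChar.norm_apply (ZMod.stdAddChar (N := p)) ((n : ZMod p)⁻¹ * (j : ZMod p))).trans_ne one_ne_zero)
    generalize ZMod.stdAddChar ((n : ZMod p)⁻¹ * (j : ZMod p)) = w at this ⊢
    field_simp
  have hlower : (M : ℝ) * M / 2 ≤ W * M := by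
    rw [hTcard] at hupper
    refine le_trans ?_ hupper
    rw [← one_mul ‖_‖, ← hκ1, ← norm_mul]
    refine le_trans ?_ (Complex.re_le_norm _)
    simp only [Finset.mul_sum, Complex.re_sum]
    calc (M : ℝ) * M / 2 = ∑ t ∈ T, ∑ u ∈ T, (1 / 2 : ℝ) := by simp [hTcard]; ring
      _ ≤ _ := Finset.sum_le_sum fun t ht => Finset.sum_le_sum fun u hu => hre t ht u hu
  have hW0 : 0 ≤ W := (norm_nonneg _).trans (hW 0)
  rcases Nat.eq_zero_or_pos M with h0 | h0
  · rw [h0]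
    push_cast
    linarith
  · have : (0 : ℝ) < M := by exact_mod_cast h0
    nlinarith

theorem stdAddChar_inv_two_mul {p : ℕ} [NeZero p] (hp : Odd p) (v : ℕ) :
    ZMod.stdAddChar ((2 : ZMod p)⁻¹ * (v : ZMod p)) = (-1) ^ v * Complex.exp ((Real.pi * v / p : ℝ) * Complex.I) := by
  obtain ⟨h, rfl⟩ := hp
  have hp0 : ((2 * h + 1 : ℕ) : ℂ) ≠ 0 := Nat.cast_ne_zero.mpr (by omega)
  have h2 : (2 : ZMod (2 * h + 1)) * (h + 1 : ℕ) = 1 := by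
    have : ((2 * h + 1 : ℕ) : ZMod (2 * h + 1)) = 0 := ZMod.natCast_self _
    push_cast at this ⊢
    linear_combination this
  have h2' : (2 : ZMod (2 * h + 1))⁻¹ = (h + 1 : ℕ) := ZMod.inv_eq_of_mul_eq_one _ _ _ h2
  have hv : (2 : ZMod (2 * h + 1))⁻¹ * (v : ZMod (2 * h + 1)) = (((h + 1) * v : ℕ) : ℤ) := by
    rw [h2']
    push_cast
    ring
  rw [hv, ZMod.stdAddChar_coe, ← Complex.exp_pi_mul_I, ← Complex.exp_nat_mul, ← Complex.exp_add]
  congr 1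
  push_cast at hp0 ⊢
  field_simp
  ring

theorem im_stdAddChar_inv_two_mul {p : ℕ} [NeZero p] (hp : Odd p) (x : ZMod p) :
    (ZMod.stdAddChar ((2 : ZMod p)⁻¹ * x)).im = (-1) ^ x.val * Real.sin (Real.pi * x.val / p) := by
  conv_lhs => rw [← ZMod.natCast_zmod_val x]
  rw [stdAddChar_inv_two_mul hp, show ((-1 : ℂ)) ^ x.val = (((-1) ^ x.val : ℝ) : ℂ) by push_cast; rfl,
    Complex.im_ofReal_mul, Complex.exp_ofReal_mul_I_im]

theorem le_sum_sin {p : ℕ} (hp : 100 ≤ p) :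
    3 / 5 * (p : ℝ) ≤ ∑ v ∈ Finset.range p, Real.sin (Real.pi * v / p) := by
  have hp' : (100 : ℝ) ≤ p := by exact_mod_cast hp
  have hpi := Real.pi_pos
  have hpi' := Real.pi_lt_d2
  set θ : ℝ := Real.pi / (2 * p) with hθ
  have hθ0 : 0 < θ := by positivity
  have hθ1 : θ * p = Real.pi / 2 := by rw [hθ]; field_simp
  have htel : ∑ v ∈ Finset.range p, Real.sin (Real.pi * v / p) * (2 * Real.sin θ)
      = 2 * Real.cos θ := by
    have : ∀ v ∈ Finset.range p, Real.sin (Real.pi * v / p) * (2 * Real.sin θ)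
        = Real.cos (Real.pi * v / p - θ) - Real.cos (Real.pi * (v + 1 : ℕ) / p - θ) := by
      intro v _
      have : Real.pi * (v + 1 : ℕ) / p - θ = Real.pi * v / p + θ := by
        rw [hθ]; push_cast; field_simp; ring
      rw [this, Real.cos_sub, Real.cos_add]
      ring
    rw [Finset.sum_congr rfl this, Finset.sum_range_sub' (fun v : ℕ => Real.cos (Real.pi * v / p - θ))]
    have h1 : Real.pi * (p : ℕ) / p - θ = Real.pi - θ := by field_simp
    rw [h1, Real.cos_pi_sub]
    simp
    ring
  rw [← Finset.sum_mul] at htel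
  set S := ∑ v ∈ Finset.range p, Real.sin (Real.pi * v / p)
  have hS : 0 ≤ S := Finset.sum_nonneg fun v hv => by
    have hv' : (v : ℝ) ≤ p := by exact_mod_cast (Finset.mem_range.mp hv).le
    refine Real.sin_nonneg_of_nonneg_of_le_pi (by positivity) ?_
    rw [div_le_iff₀ (by linarith)]
    exact mul_le_mul_of_nonneg_left hv' hpi.le
  have hsin : Real.sin θ ≤ θ := Real.sin_le hθ0.le
  have hcos : 1 - θ ^ 2 / 2 ≤ Real.cos θ := Real.one_sub_sq_div_two_le_cos
  have hθs : θ ≤ 0.016 := by nlinarith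
  have h2 : 0.99 ≤ S * θ := by nlinarith
  have h3 : 0.99 * p ≤ S * (Real.pi / 2) := by rw [← hθ1]; nlinarith
  nlinarith

/-- If `g` permutes the nonzero residues and the parity of `x + g x` is constant, then some twisted
exponential sum of `g` is large. -/
theorem le_of_parity {p : ℕ} [Fact p.Prime] (hp : Odd p) {g : ZMod p → ZMod p} {W ε : ℝ}
    (hW : ∀ b, ‖∑ x ∈ Finset.univ.filter (fun x : ZMod p => x ≠ 0),
      ZMod.stdAddChar ((2 : ZMod p)⁻¹ * g x + b * x)‖ ≤ W)
    (hg0 : ∀ x, x ≠ 0 → g x ≠ 0) (hinj : ∀ x y, x ≠ 0 → y ≠ 0 → g x = g y → x = y)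
    (hε : |ε| = 1) (hpar : ∀ x, x ≠ 0 → (-1 : ℝ) ^ (x.val + (g x).val) = ε) :
    2 * ∑ v ∈ Finset.range p, Real.sin (Real.pi * v / p) - p ≤ W := by
  classical
  set X := Finset.univ.filter (fun x : ZMod p => x ≠ 0) with hX
  have hXm : ∀ {x}, x ∈ X ↔ x ≠ 0 := by simp [hX]
  set σ : ZMod p → ℝ := fun x => Real.sin (Real.pi * x.val / p) with hσ
  have hsum : ∑ x ∈ X, σ x = ∑ v ∈ Finset.range p, Real.sin (Real.pi * v / p) := by
    have h0 : ∑ x ∈ X, σ x = ∑ x, σ x := by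
      refine Finset.sum_subset (Finset.subset_univ _) fun x _ hx => ?_
      have : x = 0 := by simpa [hX] using hx
      simp [hσ, this]
    rw [h0]
    refine Finset.sum_nbij' ZMod.val (fun v : ℕ => (v : ZMod p)) ?_ ?_ ?_ ?_ ?_
    · exact fun x _ => Finset.mem_range.mpr (ZMod.val_lt x)
    · exact fun _ _ => Finset.mem_univ _
    · exact fun x _ => ZMod.natCast_zmod_val x
    · exact fun v hv => ZMod.val_cast_of_lt (Finset.mem_range.mp hv)
    · exact fun _ _ => rfl
  have hinj' : Set.InjOn g X := fun x hx y hy => hinj x y (hXm.mp hx) (hXm.mp hy)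
  have himg : X.image g = X :=
    Finset.eq_of_subset_of_card_le
      (Finset.image_subset_iff.mpr fun x hx => hXm.mpr (hg0 x (hXm.mp hx)))
      (Finset.card_image_of_injOn hinj').ge
  have hsum' : ∑ x ∈ X, σ (g x) = ∑ x ∈ X, σ x := by
    conv_rhs => rw [← himg]
    rw [Finset.sum_image hinj']
  have hlow : 2 * ∑ x ∈ X, σ x - p ≤ ∑ x ∈ X, σ x * σ (g x) := by
    have hc : (X.card : ℝ) ≤ p := by
      have := Finset.card_le_univ X
      rw [ZMod.card] at this
      exact_mod_cast this
    have : ∑ x ∈ X, (σ x + σ (g x) - 1) ≤ ∑ x ∈ X, σ x * σ (g x) :=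
      Finset.sum_le_sum fun x _ => by
        nlinarith [Real.sin_le_one (Real.pi * x.val / p), Real.sin_le_one (Real.pi * (g x).val / p)]
    rw [Finset.sum_sub_distrib, Finset.sum_add_distrib, hsum', Finset.sum_const, nsmul_one] at this
    linarith
  have hεs : ∑ x ∈ X, (ZMod.stdAddChar ((2 : ZMod p)⁻¹ * g x)).im
      * (ZMod.stdAddChar ((2 : ZMod p)⁻¹ * x)).im = ε * ∑ x ∈ X, σ x * σ (g x) := by
    rw [Finset.mul_sum]
    refine Finset.sum_congr rfl fun x hx => ?_
    rw [im_stdAddChar_inv_two_mul hp, im_stdAddChar_inv_two_mul hp, ← hpar x (hXm.mp hx), pow_add]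
    ring
  have hprod : ∀ x ∈ X, (ZMod.stdAddChar ((2 : ZMod p)⁻¹ * g x)).im
      * (ZMod.stdAddChar ((2 : ZMod p)⁻¹ * x)).im
      = ((ZMod.stdAddChar ((2 : ZMod p)⁻¹ * g x + -2⁻¹ * x)).re
        - (ZMod.stdAddChar ((2 : ZMod p)⁻¹ * g x + 2⁻¹ * x)).re) / 2 := by
    intro x _
    rw [neg_mul, AddChar.map_add_eq_mul, AddChar.map_add_eq_mul, AddChar.map_neg_eq_conj]
    simp only [Complex.mul_re, Complex.conj_re, Complex.conj_im]
    ring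
  rw [Finset.sum_congr rfl hprod, ← Finset.sum_div, Finset.sum_sub_distrib, ← Complex.re_sum,
    ← Complex.re_sum] at hεs
  have h1 := (Complex.abs_re_le_norm _).trans (hW (-2⁻¹))
  have h2 := (Complex.abs_re_le_norm _).trans (hW 2⁻¹)
  have h3 : |ε * ∑ x ∈ X, σ x * σ (g x)| ≤ W := by
    rw [← hεs, abs_le]
    rw [abs_le] at h1 h2
    constructor <;> linarith
  rw [abs_mul, hε, one_mul] at h3
  rw [← hsum]
  exact hlow.trans ((le_abs_self _).trans h3)

theorem fmapz_eq_val_mul_zpow (p : ℕ) [Fact p.Prime] (A k : ℤ) (x : ℕ) :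
    fmapz p A k x = ((A : ZMod p) * (x : ZMod p) ^ k).val := by
  rw [fmapz]
  split_ifs with hk
  · rw [← zpow_natCast, Int.toNat_of_nonneg hk]
  · rw [← zpow_natCast, Int.toNat_of_nonneg (by omega), inv_zpow', neg_neg]

theorem ZMod.zpow_injOn_ne_zero {p : ℕ} [Fact p.Prime] {k : ℤ} (hk : Int.gcd k ((p : ℤ) - 1) = 1)
    {x y : ZMod p} (hx : x ≠ 0) (hy : y ≠ 0) (hxy : x ^ k = y ^ k) : x = y := by
  have hp1 : 1 ≤ p := (Fact.out : p.Prime).one_lt.le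
  have h1 : (x / y) ^ k = 1 := by rw [div_zpow, hxy, div_self (zpow_ne_zero _ hy)]
  have h2 : (x / y) ^ ((p : ℤ) - 1) = 1 := by
    rw [← Nat.cast_pred (by omega), zpow_natCast]
    exact ZMod.pow_card_sub_one_eq_one (div_ne_zero hx hy)
  have h3 : (x / y) ^ (1 : ℤ) = 1 := by
    rw [← Int.natCast_one, ← hk, Int.gcd_eq_gcd_ab, zpow_add₀ (div_ne_zero hx hy), zpow_mul,
      zpow_mul, h1, h2, one_zpow, one_zpow, mul_one]
  rw [zpow_one] at h3
  exact (div_eq_one_iff_eq hy).mp h3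

theorem mem_Iclass_val {p n i : ℕ} [NeZero p] {x : ZMod p} :
    x.val ∈ Iclass p n i ↔ x ≠ 0 ∧ x.val % n = i := by
  have h := ZMod.val_lt x
  rw [Iclass, Finset.mem_filter, Finset.mem_Icc, Nat.one_le_iff_ne_zero, Ne, ZMod.val_eq_zero]
  exact and_congr_left fun _ => ⟨fun h => h.1, fun h => ⟨h, by omega⟩⟩

theorem neg_one_pow_val_add_val {p i j : ℕ} [Fact p.Prime] (hp : Odd p) {g : ZMod p → ZMod p}
    (hi : i < 2) (hg0 : ∀ x, x ≠ 0 → g x ≠ 0) (hneg : ∀ x, g (-x) = -g x)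
    (hg : ∀ x, x ≠ 0 → x.val % 2 = i → (g x).val % 2 = j) {x : ZMod p} (hx : x ≠ 0) :
    (-1 : ℝ) ^ (x.val + (g x).val) = (-1) ^ (i + j) := by
  have key : ∀ y, y ≠ 0 → y.val % 2 = i → (-1 : ℝ) ^ (y.val + (g y).val) = (-1) ^ (i + j) := by
    intro y hy hyi
    rw [pow_add, pow_add, ← hyi, ← hg y hy hyi, ← neg_one_pow_eq_pow_mod_two,
      ← neg_one_pow_eq_pow_mod_two]
  by_cases hxi : x.val % 2 = i
  · exact key x hx hxi
  have hval : ∀ y : ZMod p, y ≠ 0 → y.val + (-y).val = p := by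
    intro y hy
    have : NeZero y := ⟨hy⟩
    have := ZMod.val_lt y
    rw [ZMod.val_neg_of_ne_zero]
    omega
  have h1 := hval x hx
  have h2 := hval (g x) (hg0 x hx)
  obtain ⟨h, hh⟩ := hp
  rw [← key (-x) (neg_ne_zero.mpr hx) (by omega), hneg]
  refine neg_one_pow_congr ?_
  rw [Nat.even_iff, Nat.even_iff]
  omega

theorem stmt_4 (p n : ℕ) (A k : ℤ) (hp : p.Prime) (hodd : Odd p) (hn : 2 ≤ n)
    (hA : 2 * |A| < (p : ℤ)) (hA0 : A ≠ 0)
    (hk1 : k ≠ 1) (hk2 : 2 * |k| < (p : ℤ) - 1) (hk3 : Int.gcd k ((p : ℤ) - 1) = 1)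
    (hbig : 37 * (k - 1) ^ 2 * (n : ℤ) ^ 2 < (p : ℤ)) :
    ∀ i j : ℕ, i ≤ n - 1 → j ≤ n - 1 →
      ¬ ((Iclass p n i).image (fmapz p A k) ⊆ Iclass p n j) := by
  intro i j hi _ hsub
  have : Fact p.Prime := ⟨hp⟩
  have not_dvd : ∀ m : ℤ, m ≠ 0 → |m| < p → ¬ (p : ℤ) ∣ m := fun m hm hmp h =>
    hm (Int.eq_zero_of_abs_lt_dvd h hmp)
  have hA' : (A : ZMod p) ≠ 0 := by
    rw [Ne, ZMod.intCast_zmod_eq_zero_iff_dvd]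
    exact not_dvd A hA0 (by linarith [abs_nonneg A])
  have hkodd : Odd k := by
    rw [← Int.not_even_iff_odd]
    intro hk
    have h2 : (2 : ℤ) ∣ Int.gcd k ((p : ℤ) - 1) :=
      Int.dvd_coe_gcd hk.two_dvd ((Int.odd_coe_nat p).mpr hodd |>.sub_odd odd_one).two_dvd
    rw [hk3] at h2
    omega
  have hk0 : k ≠ 0 := by
    rintro rfl
    exact Int.not_odd_zero hkodd
  have hD : 2 ≤ |k - 1| := by
    have h1 : k - 1 ≠ 0 := sub_ne_zero.mpr hk1
    obtain ⟨r, rfl⟩ := hkodd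
    rcases abs_cases (2 * r + 1 - 1) with h | h <;> omega
  set D : ℤ := |k - 1| with hDdef
  have hbig' : 37 * (D : ℝ) ^ 2 * (n : ℝ) ^ 2 < p := by
    rw [← sq_abs] at hbig
    exact_mod_cast hbig
  have hD' : (2 : ℝ) ≤ D := by exact_mod_cast hD
  have hn' : (2 : ℝ) ≤ n := by exact_mod_cast hn
  have hr : 6 * (D : ℝ) * n < √p := by
    refine Real.lt_sqrt_of_sq_lt ?_
    nlinarith [mul_pos (show (0 : ℝ) < D by linarith) (show (0 : ℝ) < n by linarith)]
  have hrp : √(p : ℝ) * √p = p := Real.mul_self_sqrt (Nat.cast_nonneg p)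
  have hDn : (4 : ℝ) ≤ D * n := by nlinarith
  have hr24 : 24 < √(p : ℝ) := by nlinarith
  set g : ZMod p → ZMod p := fun x => (A : ZMod p) * x ^ k with hgdef
  have hW : ∀ c : ZMod p, c ≠ 0 → ∀ b, ‖∑ x ∈ Finset.univ.filter (fun x : ZMod p => x ≠ 0),
      ZMod.stdAddChar (c * g x + b * x)‖ ≤ D * √p + 1 := by
    intro c hc b
    have h := norm_sum_addChar_zpow_le (ψ := ZMod.stdAddChar) (p := p)
      (by simpa using ZMod.isPrimitive_stdAddChar p one_ne_zero) hk1
      (not_dvd k hk0 (by linarith [abs_nonneg k])) (mul_ne_zero hc hA') b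
    simpa only [hgdef, mul_assoc] using h
  have hg0 : ∀ x, x ≠ 0 → g x ≠ 0 := fun x hx => mul_ne_zero hA' (zpow_ne_zero _ hx)
  have hg : ∀ x ∈ Iclass p n i, (g x).val % n = j := by
    intro x hx
    have := hsub (Finset.mem_image_of_mem _ hx)
    rw [fmapz_eq_val_mul_zpow] at this
    exact (mem_Iclass_val.mp this).2
  have hnp : n < p := by
    have : (n : ℝ) < p := by nlinarith
    exact_mod_cast this
  have hpnat : 100 ≤ p := by
    have : (100 : ℝ) ≤ p := by nlinarith
    exact_mod_cast this
  rcases hn.eq_or_lt with rfl | hn3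
  · have hpar : ∀ x, x ≠ 0 → (-1 : ℝ) ^ (x.val + (g x).val) = (-1) ^ (i + j) := fun x hx =>
      neg_one_pow_val_add_val hodd (by omega) hg0
        (fun x => by rw [hgdef]; simp only [hkodd.neg_zpow, mul_neg])
        (fun x hx hxi => by simpa using hg x.val (mem_Iclass_val.mpr ⟨hx, hxi⟩)) hx
    have h2 : (2 : ZMod p)⁻¹ ≠ 0 := by
      refine inv_ne_zero fun h => ?_
      have : ((2 : ℕ) : ZMod p) = 0 := by exact_mod_cast h
      rw [CharP.cast_eq_zero_iff (ZMod p) p] at this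
      exact absurd (Nat.le_of_dvd two_pos this) (by omega)
    have hle := le_of_parity hodd (hW _ h2) hg0
      (fun x y hx hy hxy => ZMod.zpow_injOn_ne_zero hk3 hx hy (mul_left_cancel₀ hA' hxy))
      (by simp) hpar
    have hsin := le_sum_sin hpnat
    push_cast at hr
    nlinarith
  · have hle := div_le_of_image_Iclass_subset hn3 hnp (by omega)
      (hW _ (inv_ne_zero (a := (n : ZMod p)) (by
        rw [Ne, CharP.cast_eq_zero_iff (ZMod p) p]
        exact Nat.not_dvd_of_pos_of_lt (by omega) hnp))) hg
    have hM : p ≤ 2 * n * ((p - 1) / (2 * n) + 1) := by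
      have := Nat.lt_mul_div_succ (p - 1) (show 0 < 2 * n by omega)
      omega
    have hM' : (p : ℝ) ≤ 2 * n * (((p - 1) / (2 * n) : ℕ) + 1) := by exact_mod_cast hM
    have h1 : (p : ℝ) ≤ 2 * n * (2 * (D * √p + 1) + 1) :=
      hM'.trans (mul_le_mul_of_nonneg_left (by linarith) (by positivity))
    have h2 : 6 * (D : ℝ) * n * √p < p := by rw [← hrp]; nlinarith
    have h3 : (D : ℝ) * √p > 3 := by nlinarith
    nlinarith
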